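/- arXiv:1408.2322 — 8 statements merged into one kernel-verified Lean document; each statement's English description precedes it below -/
import Mathlib

section
/- Let L be a Finsler metric on U with L(x,y) ≠ 0 on U. Fix D with 0 ≤ D ≤ n−1 and let smooth maps v_I : U → ℝ^{n+1} (I = 1,…,D) be pointwise linearly independent and satisfy Σ_ν L_{μν} v_I^ν = 0 and Σ_μ p_μ v_I^μ = 0 on U, and suppose that at each point of U the (n−D)×(n−D) submatrix (L_{ab})_{a,b = D+1,…,n} is invertible. Then at every point (x,y) ∈ U the n+1 vectors ℓ₀ := y/L(x,y), ℓ_I := v_I(x,y) (I = 1,…,D), and ℓ_a := e_a − (p_a(x,y)/L(x,y)) y (a = D+1,…,n, where e_a is the a-th standard basis vector) are linearly independent in ℝ^{n+1}. -/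
open scoped BigOperators

noncomputable section

/-- Points/vectors in `ℝ^{n+1}`. -/
abbrev Vec (n : ℕ) := Fin (n + 1) → ℝ

/-- Partial derivative of `f : U ⊆ ℝ^{n+1} × ℝ^{n+1} → ℝ` with respect to the base
coordinate `x^μ`. -/
def pdx {n : ℕ} (μ : Fin (n + 1)) (f : Vec n × Vec n → ℝ) (z : Vec n × Vec n) : ℝ :=
  fderiv ℝ f z (Pi.single μ 1, 0)

/-- Partial derivative with respect to the fibre coordinate `y^μ`. -/
def pdy {n : ℕ} (μ : Fin (n + 1)) (f : Vec n × Vec n → ℝ) (z : Vec n × Vec n) : ℝ :=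
  fderiv ℝ f z (0, Pi.single μ 1)

/-- The index `I ∈ {1,…,D}` viewed inside `{0,…,n}`. -/
def idxI {n D : ℕ} (hD : D + 1 ≤ n) (i : Fin D) : Fin (n + 1) :=
  ⟨i.1 + 1, by have := i.isLt; omega⟩

/-- The index `a ∈ {D+1,…,n}` viewed inside `{0,…,n}`. -/
def idxa {n D : ℕ} (hD : D + 1 ≤ n) (a : Fin (n - D)) : Fin (n + 1) :=
  ⟨D + 1 + a.1, by have := a.isLt; omega⟩

theorem aux_expand {n : ℕ} (L : Vec n × Vec n → ℝ) (z : Vec n × Vec n) (w : Vec n) :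
    fderiv ℝ L z (0, w) = ∑ ν, pdy ν L z * w ν := by
  have h : ((0 : Vec n), w) = ∑ ν, w ν • ((0 : Vec n), (Pi.single ν (1 : ℝ) : Vec n)) := by
    refine Prod.ext ?_ ?_
    · simp [Prod.fst_sum]
    · ext μ
      simp [Prod.snd_sum, Finset.sum_apply, Pi.single_apply]
  rw [h, map_sum]
  refine Finset.sum_congr rfl fun ν _ => ?_
  rw [map_smul, smul_eq_mul, mul_comm]
  rfl

theorem aux_euler {n : ℕ} (U : Set (Vec n × Vec n)) (hUopen : IsOpen U)
    (L : Vec n × Vec n → ℝ)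
    (hLsmooth : ContDiffOn ℝ (⊤ : ℕ∞) L U)
    (hLhom : ∀ z ∈ U, ∀ lam : ℝ, 0 < lam → L (z.1, lam • z.2) = lam * L z)
    (z : Vec n × Vec n) (hz : z ∈ U) : ∑ ν, pdy ν L z * z.2 ν = L z := by
  rw [← aux_expand]
  have hd : DifferentiableAt ℝ L z :=
    (hLsmooth.contDiffAt (hUopen.mem_nhds hz)).differentiableAt (by simp)
  have hc : HasDerivAt (fun lam : ℝ => (z.1, lam • z.2)) ((0 : Vec n), z.2) 1 := by
    have h1 : HasDerivAt (fun lam : ℝ => lam • z.2) z.2 1 := by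
      simpa using (hasDerivAt_id (1 : ℝ)).smul_const z.2
    exact (hasDerivAt_const (1 : ℝ) z.1).prodMk h1
  have hd' : HasFDerivAt L (fderiv ℝ L z) (z.1, (1 : ℝ) • z.2) := by
    simpa using hd.hasFDerivAt
  have h2 := hd'.comp_hasDerivAt (1 : ℝ) hc
  have h3 : HasDerivAt (fun lam : ℝ => lam * L z) (L z) 1 := by
    simpa using (hasDerivAt_id (1 : ℝ)).mul_const (L z)
  have h4 : (L ∘ fun lam : ℝ => (z.1, lam • z.2)) =ᶠ[nhds 1] fun lam : ℝ => lam * L z := by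
    filter_upwards [lt_mem_nhds (zero_lt_one : (0 : ℝ) < 1)] with lam hl
    exact hLhom z hz lam hl
  exact h2.unique (h3.congr_of_eventuallyEq h4)

theorem aux_hess {n : ℕ} (U : Set (Vec n × Vec n)) (hUopen : IsOpen U)
    (L : Vec n × Vec n → ℝ)
    (hLsmooth : ContDiffOn ℝ (⊤ : ℕ∞) L U)
    (hLhom : ∀ z ∈ U, ∀ lam : ℝ, 0 < lam → L (z.1, lam • z.2) = lam * L z)
    (z : Vec n × Vec n) (hz : z ∈ U) (μ : Fin (n + 1)) :
    ∑ ν, pdy μ (pdy ν L) z * z.2 ν = 0 := by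
  have hp : ∀ ν, DifferentiableAt ℝ (pdy ν L) z := by
    intro ν
    have h1 : ContDiffAt ℝ 1 (fderiv ℝ L) z :=
      (hLsmooth.contDiffAt (hUopen.mem_nhds hz)).fderiv_right (by norm_cast)
    exact (h1.differentiableAt (by simp)).clm_apply (differentiableAt_const _)
  have hy : ∀ ν : Fin (n + 1), HasFDerivAt (fun w : Vec n × Vec n => w.2 ν)
      ((ContinuousLinearMap.proj ν).comp (ContinuousLinearMap.snd ℝ (Vec n) (Vec n))) z :=
    fun ν => ((ContinuousLinearMap.proj (R := ℝ) (φ := fun _ : Fin (n + 1) => ℝ) ν).comp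
      (ContinuousLinearMap.snd ℝ (Vec n) (Vec n))).hasFDerivAt
  have hs := HasFDerivAt.fun_sum (u := Finset.univ)
    fun ν (_ : ν ∈ Finset.univ) => (hp ν).hasFDerivAt.mul (hy ν)
  have he : (fun w : Vec n × Vec n => ∑ ν, pdy ν L w * w.2 ν) =ᶠ[nhds z] L := by
    filter_upwards [hUopen.mem_nhds hz] with w hw
    exact aux_euler U hUopen L hLsmooth hLhom w hw
  have h5 := he.fderiv_eq (𝕜 := ℝ)
  have h6 := hs.fderiv
  have h7 := congrArg (fun A : (Vec n × Vec n) →L[ℝ] ℝ => A (0, Pi.single μ 1)) (h6.symm.trans h5)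
  have h8 : fderiv ℝ L z (0, Pi.single μ 1) = pdy μ L z := rfl
  simp [ContinuousLinearMap.sum_apply, Finset.sum_add_distrib, Pi.single_apply, h8] at h7
  rw [← h7]
  exact Finset.sum_congr rfl fun ν _ => mul_comm _ _

/-- For a nowhere-vanishing Finsler metric with `D` pointwise independent
null vector fields `v_I` of the `y`-Hessian which are also `p`-orthogonal, and with
the submatrix `(L_{ab})_{a,b=D+1,…,n}` invertible, the `n+1` vectors
`ℓ₀ = y/L`, `ℓ_I = v_I`, `ℓ_a = e_a − (p_a/L) y` are linearly independent. -/
theorem statement1 {n D : ℕ} (hn : 1 ≤ n) (hD : D + 1 ≤ n)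
    (U : Set (Vec n × Vec n)) (hUopen : IsOpen U)
    (hUslit : ∀ z ∈ U, z.2 ≠ 0)
    (hconic : ∀ z ∈ U, ∀ lam : ℝ, 0 < lam → (z.1, lam • z.2) ∈ U)
    (L : Vec n × Vec n → ℝ)
    (hLsmooth : ContDiffOn ℝ (⊤ : ℕ∞) L U)
    (hLhom : ∀ z ∈ U, ∀ lam : ℝ, 0 < lam → L (z.1, lam • z.2) = lam * L z)
    (hLne : ∀ z ∈ U, L z ≠ 0)
    (v : Fin D → Vec n × Vec n → Vec n)
    (hvsmooth : ∀ i μ, ContDiffOn ℝ (⊤ : ℕ∞) (fun z => v i z μ) U)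
    (hvindep : ∀ z ∈ U, LinearIndependent ℝ (fun i : Fin D => v i z))
    (hvker : ∀ z ∈ U, ∀ i : Fin D, ∀ μ, ∑ ν, pdy μ (pdy ν L) z * v i z ν = 0)
    (hvp : ∀ z ∈ U, ∀ i : Fin D, ∑ μ, pdy μ L z * v i z μ = 0)
    (hsub : ∀ z ∈ U,
      IsUnit (Matrix.of fun a b : Fin (n - D) =>
        pdy (idxa hD a) (pdy (idxa hD b) L) z)) :
    ∀ z ∈ U, LinearIndependent ℝ
      (Sum.elim (fun _ : Unit => fun μ => z.2 μ / L z)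
        (Sum.elim (fun i : Fin D => v i z)
          (fun a : Fin (n - D) => fun μ =>
            (if μ = idxa hD a then (1 : ℝ) else 0) - pdy (idxa hD a) L z * z.2 μ / L z))) := by
  intro z hz
  have hL := hLne z hz
  have hE := aux_euler U hUopen L hLsmooth hLhom z hz
  have hH := aux_hess U hUopen L hLsmooth hLhom z hz
  rw [Fintype.linearIndependent_iff]
  intro g hg
  simp only [Fintype.sum_sum_type, Finset.univ_unique, Finset.sum_singleton, Sum.elim_inl,
    Sum.elim_inr] at hg
  -- contraction with an arbitrary covector
  have key : ∀ q : Fin (n + 1) → ℝ,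
      (∀ i, ∑ μ, q μ * v i z μ = 0) →
      g (Sum.inl default) * ((∑ μ, q μ * z.2 μ) / L z) +
      ∑ a, g (Sum.inr (Sum.inr a)) *
        (q (idxa hD a) - pdy (idxa hD a) L z * (∑ μ, q μ * z.2 μ) / L z) = 0 := by
    intro q hq
    have h1 := congrArg (fun w : Vec n => q ⬝ᵥ w) hg
    simp only [dotProduct_add, dotProduct_smul, dotProduct_sum, dotProduct_zero] at h1
    have e1 : (q ⬝ᵥ fun μ => z.2 μ / L z) = (∑ μ, q μ * z.2 μ) / L z := by
      simp only [dotProduct, Finset.sum_div, mul_div_assoc]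
    have e2 : ∀ i, q ⬝ᵥ v i z = 0 := hq
    have e3 : ∀ a : Fin (n - D), (q ⬝ᵥ fun μ =>
        (if μ = idxa hD a then (1 : ℝ) else 0) - pdy (idxa hD a) L z * z.2 μ / L z)
        = q (idxa hD a) - pdy (idxa hD a) L z * (∑ μ, q μ * z.2 μ) / L z := by
      intro a
      simp only [dotProduct, mul_sub, Finset.sum_sub_distrib, Finset.mul_sum, Finset.sum_div]
      congr 1
      · simp
      · exact Finset.sum_congr rfl fun μ _ => by ring
    simp only [e1, e2, e3, smul_eq_mul, mul_zero, Finset.sum_const_zero, zero_add] at h1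
    exact h1
  have h0 : g (Sum.inl default) = 0 := by
    have := key (fun μ => pdy μ L z) (hvp z hz)
    simpa [hE, hL] using this
  have ha : (fun a => g (Sum.inr (Sum.inr a))) = 0 := by
    apply Matrix.mulVec_injective_of_isUnit (hsub z hz)
    ext b
    have := key (fun ν => pdy (idxa hD b) (pdy ν L) z) (fun i => hvker z hz i _)
    simp only [hH, h0] at this
    simp only [Matrix.mulVec, dotProduct, Matrix.of_apply, Pi.zero_apply, mul_zero,
      Finset.sum_const_zero]
    rw [← this]
    simp [mul_comm]
  have ha' : ∀ a, g (Sum.inr (Sum.inr a)) = 0 := fun a => congrFun ha a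
  simp only [h0, ha', zero_smul, Finset.sum_const_zero, zero_add, add_zero] at hg
  have hi := Fintype.linearIndependent_iff.1 (hvindep z hz) _ hg
  rintro (u | i | a)
  · exact h0
  · exact hi i
  · exact ha' a
end
end

section
/- Let L be a Finsler metric on U and fix a point (x,y) ∈ U with y⁰ ≠ 0. Fix 0 ≤ D ≤ n−1 and define M_μ := ½(−∂L/∂x^μ + Σ_ρ y^ρ ∂²L/∂y^μ∂x^ρ). Suppose real numbers λ^a (a = D+1,…,n) satisfy Σ_a L_{ba} λ^a = M_b for all b = D+1,…,n and Σ_a L_{Ia} λ^a = M_I for all I = 1,…,D at (x,y). Then also Σ_a L_{0a} λ^a = M_0 at (x,y). (In particular one uses that positive 1-homogeneity of L implies Σ_ν L_{μν} y^ν = 0 and Σ_μ y^μ M_μ = 0.) -/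
open scoped BigOperators

noncomputable section

/-- `M_μ := ½(−∂L/∂x^μ + Σ_ρ y^ρ ∂²L/∂y^μ∂x^ρ)`. -/
def Mfun {n : ℕ} (L : Vec n × Vec n → ℝ) (μ : Fin (n + 1)) (z : Vec n × Vec n) : ℝ :=
  (1 : ℝ) / 2 * (-(pdx μ L z) + ∑ ρ, z.2 ρ * pdy μ (pdx ρ L) z)

/-- Euler's relation along the fibre direction. -/
lemma euler_aux {n : ℕ} (f : Vec n × Vec n → ℝ) (z : Vec n × Vec n)
    (hf : DifferentiableAt ℝ f z) (g : ℝ → ℝ) (c : ℝ) (hg : HasDerivAt g c 1)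
    (h : ∀ t : ℝ, 0 < t → f (z.1, t • z.2) = g t) :
    ∑ μ, z.2 μ * pdy μ f z = c := by
  have h1 : HasDerivAt (fun t : ℝ => (z.1, t • z.2)) ((0 : Vec n), z.2) 1 := by
    have h2 : HasDerivAt (fun t : ℝ => t • z.2) ((1 : ℝ) • z.2) 1 :=
      (hasDerivAt_id (1 : ℝ)).smul_const z.2
    rw [one_smul] at h2
    exact (hasDerivAt_const (1 : ℝ) z.1).prodMk h2
  have hz1 : (z.1, (1 : ℝ) • z.2) = z := by simp
  have h3 : HasDerivAt (fun t : ℝ => f (z.1, t • z.2)) (fderiv ℝ f z ((0 : Vec n), z.2)) 1 := by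
    have h4 : HasFDerivAt f (fderiv ℝ f z) ((fun t : ℝ => (z.1, t • z.2)) 1) := by
      simpa only [hz1] using hf.hasFDerivAt
    exact h4.comp_hasDerivAt (1 : ℝ) h1
  have h5 : HasDerivAt (fun t : ℝ => f (z.1, t • z.2)) c 1 := by
    refine hg.congr_of_eventuallyEq ?_
    filter_upwards [lt_mem_nhds (zero_lt_one' ℝ)] with t ht using h t ht
  rw [← h3.unique h5]
  have h6 : ((0 : Vec n), z.2) = ∑ μ, z.2 μ • ((0 : Vec n), (Pi.single μ (1 : ℝ) : Vec n)) := by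
    refine Prod.ext ?_ ?_
    · simp [Prod.fst_sum]
    · rw [Prod.snd_sum]
      exact pi_eq_sum_univ' z.2
  rw [h6, map_sum]
  refine Finset.sum_congr rfl fun μ _ => ?_
  rw [map_smul, smul_eq_mul, pdy]

/-- Scaling of the differential of a 1-homogeneous function. -/
lemma fderiv_scale {n : ℕ} (U : Set (Vec n × Vec n)) (hUopen : IsOpen U)
    (hconic : ∀ z ∈ U, ∀ lam : ℝ, 0 < lam → (z.1, lam • z.2) ∈ U)
    (L : Vec n × Vec n → ℝ) (hd : ∀ z ∈ U, DifferentiableAt ℝ L z)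
    (hLhom : ∀ z ∈ U, ∀ lam : ℝ, 0 < lam → L (z.1, lam • z.2) = lam * L z)
    (z : Vec n × Vec n) (hz : z ∈ U) (t : ℝ) (ht : 0 < t) (v : Vec n × Vec n) :
    fderiv ℝ L (z.1, t • z.2) (v.1, t • v.2) = t * fderiv ℝ L z v := by
  let S : (Vec n × Vec n) →L[ℝ] (Vec n × Vec n) :=
    (ContinuousLinearMap.fst ℝ (Vec n) (Vec n)).prod
      (t • ContinuousLinearMap.snd ℝ (Vec n) (Vec n))
  have h1 : HasFDerivAt (fun w => L (S w)) ((fderiv ℝ L (S z)).comp S) z :=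
    HasFDerivAt.comp z (hd (S z) (hconic z hz t ht)).hasFDerivAt S.hasFDerivAt
  have h2 : HasFDerivAt (fun w => L (S w)) (t • fderiv ℝ L z) z := by
    refine ((hd z hz).hasFDerivAt.const_mul t).congr_of_eventuallyEq ?_
    filter_upwards [hUopen.mem_nhds hz] with w hw using hLhom w hw t ht
  have h3 := congrArg (fun A : (Vec n × Vec n) →L[ℝ] ℝ => A v) (h1.unique h2)
  exact h3

/-- If `λ^a` satisfies `Σ_a L_{ba} λ^a = M_b` for `b = D+1,…,n` and
`Σ_a L_{Ia} λ^a = M_I` for `I = 1,…,D` at a point `(x,y) ∈ U` with `y⁰ ≠ 0`, then also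
`Σ_a L_{0a} λ^a = M_0` there. -/
theorem statement4 {n D : ℕ} (hn : 1 ≤ n) (hD : D + 1 ≤ n)
    (U : Set (Vec n × Vec n)) (hUopen : IsOpen U)
    (hUslit : ∀ z ∈ U, z.2 ≠ 0)
    (hconic : ∀ z ∈ U, ∀ lam : ℝ, 0 < lam → (z.1, lam • z.2) ∈ U)
    (L : Vec n × Vec n → ℝ)
    (hLsmooth : ContDiffOn ℝ (⊤ : ℕ∞) L U)
    (hLhom : ∀ z ∈ U, ∀ lam : ℝ, 0 < lam → L (z.1, lam • z.2) = lam * L z)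
    (z : Vec n × Vec n) (hz : z ∈ U) (hz0 : z.2 0 ≠ 0)
    (lam : Fin (n - D) → ℝ)
    (hb : ∀ b : Fin (n - D),
      ∑ a, pdy (idxa hD b) (pdy (idxa hD a) L) z * lam a = Mfun L (idxa hD b) z)
    (hI : ∀ i : Fin D,
      ∑ a, pdy (idxI hD i) (pdy (idxa hD a) L) z * lam a = Mfun L (idxI hD i) z) :
    ∑ a, pdy 0 (pdy (idxa hD a) L) z * lam a = Mfun L 0 z := by
  have hd : ∀ w ∈ U, DifferentiableAt ℝ L w := fun w hw =>
    (hLsmooth.contDiffAt (hUopen.mem_nhds hw)).differentiableAt (by simp)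
  have hdd : ∀ v : Vec n × Vec n, DifferentiableAt ℝ (fun w => fderiv ℝ L w v) z := by
    intro v
    have h1 : ContDiffAt ℝ 1 (fderiv ℝ L) z :=
      (hLsmooth.contDiffAt (hUopen.mem_nhds hz)).fderiv_right (by
        have h2 : ((1 + 1 : ℕ∞)) ≤ ⊤ := le_top
        exact WithTop.coe_le_coe.mpr h2)
    exact (h1.differentiableAt (by simp)).clm_apply (differentiableAt_const v)
  have hsc := fderiv_scale U hUopen hconic L hd hLhom z hz
  have hy : ∀ ν, ∑ μ, z.2 μ * pdy μ (pdy ν L) z = 0 := by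
    intro ν
    refine euler_aux (pdy ν L) z (hdd _) (fun _ => pdy ν L z) 0 (hasDerivAt_const _ _) ?_
    intro t ht
    have h := hsc t ht ((0 : Vec n), (Pi.single ν (1 : ℝ) : Vec n))
    have h2 : ((0 : Vec n), t • (Pi.single ν (1 : ℝ) : Vec n))
        = t • ((0 : Vec n), (Pi.single ν (1 : ℝ) : Vec n)) := by simp
    rw [h2, map_smul, smul_eq_mul] at h
    exact mul_left_cancel₀ ht.ne' h
  have hx : ∀ ν, ∑ μ, z.2 μ * pdy μ (pdx ν L) z = pdx ν L z := by
    intro ν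
    refine euler_aux (pdx ν L) z (hdd _) (fun t => t * pdx ν L z) _
      (by simpa using (hasDerivAt_id (1 : ℝ)).mul_const (pdx ν L z)) ?_
    intro t ht
    have h := hsc t ht ((Pi.single ν (1 : ℝ) : Vec n), (0 : Vec n))
    simpa [pdx] using h
  have hM : ∑ μ, z.2 μ * Mfun L μ z = 0 := by
    have h1 : ∑ μ, z.2 μ * ∑ ρ, z.2 ρ * pdy μ (pdx ρ L) z = ∑ ρ, z.2 ρ * pdx ρ L z := by
      simp_rw [← hx, Finset.mul_sum]
      rw [Finset.sum_comm]
      exact Finset.sum_congr rfl fun _ _ => Finset.sum_congr rfl fun _ _ => by ring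
    have h2 : ∑ μ, z.2 μ * Mfun L μ z = (1 : ℝ) / 2 * (-(∑ ρ, z.2 ρ * pdx ρ L z)
        + ∑ μ, z.2 μ * ∑ ρ, z.2 ρ * pdy μ (pdx ρ L) z) := by
      rw [← Finset.sum_neg_distrib, ← Finset.sum_add_distrib, Finset.mul_sum]
      exact Finset.sum_congr rfl fun _ _ => by rw [Mfun]; ring
    rw [h2, h1]; ring
  have hS : ∑ μ, z.2 μ * ∑ a, pdy μ (pdy (idxa hD a) L) z * lam a = 0 := by
    have h1 : ∑ μ, z.2 μ * ∑ a, pdy μ (pdy (idxa hD a) L) z * lam a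
        = ∑ a, lam a * ∑ μ, z.2 μ * pdy μ (pdy (idxa hD a) L) z := by
      simp_rw [Finset.mul_sum]
      rw [Finset.sum_comm]
      exact Finset.sum_congr rfl fun _ _ => Finset.sum_congr rfl fun _ _ => by ring
    rw [h1]; simp [hy]
  have hall : ∀ μ : Fin (n + 1), μ ≠ 0 →
      ∑ a, pdy μ (pdy (idxa hD a) L) z * lam a = Mfun L μ z := by
    intro μ hμ
    have hμ0 : μ.1 ≠ 0 := fun h => hμ (Fin.ext h)
    have hlt := μ.isLt
    by_cases hc : μ.1 ≤ D
    · have e : idxI hD ⟨μ.1 - 1, by omega⟩ = μ := by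
        apply Fin.ext; simp only [idxI]; omega
      have h := hI ⟨μ.1 - 1, by omega⟩
      rwa [e] at h
    · have e : idxa hD ⟨μ.1 - (D + 1), by omega⟩ = μ := by
        apply Fin.ext; simp only [idxa]; omega
      have h := hb ⟨μ.1 - (D + 1), by omega⟩
      rwa [e] at h
  rw [Fin.sum_univ_succ] at hM hS
  have hrest : ∑ i : Fin n, z.2 i.succ * ∑ a, pdy i.succ (pdy (idxa hD a) L) z * lam a
      = ∑ i : Fin n, z.2 i.succ * Mfun L i.succ z :=
    Finset.sum_congr rfl fun i _ => by rw [hall (Fin.succ i) (Fin.succ_ne_zero i)]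
  rw [hrest] at hS
  have h := hS.trans hM.symm
  exact mul_left_cancel₀ hz0 (add_right_cancel h)
end
end

section
/- Let L be a Finsler metric on U and let G : U → ℝ^{n+1} be a smooth map satisfying the contracted metric-preservation identity Σ_β y^β ∂L/∂x^β = 2 Σ_μ p_μ G^μ on U. Let c : I → ℝ^{n+1} be a smooth curve with (c(s), ċ(s)) ∈ U and L(c(s), ċ(s)) = 1 for all s (Finsler arc-length parameterisation), let v_I : U → ℝ^{n+1} (I = 1,…,D) satisfy Σ_μ p_μ v_I^μ = 0 on U, and suppose there exist functions ξ⁰, ξ^I : I → ℝ with c̈^μ(s) + 2G^μ(c(s),ċ(s)) = ξ⁰(s) ċ^μ(s) + Σ_I ξ^I(s) v_I^μ(c(s),ċ(s)) for all s and μ. Then ξ⁰(s) = 0 for all s. -/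
open scoped BigOperators

noncomputable section

/-- Coordinate expansion of the derivative of `f`. -/
theorem fderiv_expand {n : ℕ} (f : Vec n × Vec n → ℝ) (z : Vec n × Vec n) (a b : Vec n) :
    fderiv ℝ f z (a, b) = ∑ β, a β * pdx β f z + ∑ μ, b μ * pdy μ f z := by
  have h : (a, b) = ∑ β, a β • ((Pi.single β 1, 0) : Vec n × Vec n)
      + ∑ μ, b μ • ((0, Pi.single μ 1) : Vec n × Vec n) := by
    ext j
    · simp [Prod.fst_sum, Finset.sum_apply, Pi.single_apply]
    · simp [Prod.snd_sum, Finset.sum_apply, Pi.single_apply]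
  rw [h, map_add, map_sum, map_sum]
  simp only [map_smul, smul_eq_mul, pdx, pdy]

/-- In Finsler arc-length parameterisation (`L(c,ċ) = 1`), if
`c̈^μ + 2G^μ(c,ċ) = ξ⁰ ċ^μ + Σ_I ξ^I v_I^μ(c,ċ)` with `Σ_μ p_μ v_I^μ = 0` and
`Σ_β y^β ∂L/∂x^β = 2 Σ_μ p_μ G^μ`, then `ξ⁰ ≡ 0`. -/
theorem statement9 {n D : ℕ} (hn : 1 ≤ n)
    (U : Set (Vec n × Vec n)) (hUopen : IsOpen U)
    (hUslit : ∀ z ∈ U, z.2 ≠ 0)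
    (hconic : ∀ z ∈ U, ∀ lam : ℝ, 0 < lam → (z.1, lam • z.2) ∈ U)
    (L : Vec n × Vec n → ℝ)
    (hLsmooth : ContDiffOn ℝ (⊤ : ℕ∞) L U)
    (hLhom : ∀ z ∈ U, ∀ lam : ℝ, 0 < lam → L (z.1, lam • z.2) = lam * L z)
    -- a smooth map G with the contracted metric-preservation identity
    (G : Vec n × Vec n → Vec n)
    (hGsmooth : ∀ μ, ContDiffOn ℝ (⊤ : ℕ∞) (fun z => G z μ) U)
    (hGid : ∀ z ∈ U, ∑ β, z.2 β * pdx β L z = 2 * ∑ μ, pdy μ L z * G z μ)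
    -- a smooth curve in Finsler arc-length parameterisation
    (s₀ s₁ : ℝ) (I : Set ℝ) (hI : I = Set.Ioo s₀ s₁)
    (c : ℝ → Vec n) (hc : ContDiffOn ℝ (⊤ : ℕ∞) c I)
    (hcU : ∀ s ∈ I, (c s, deriv c s) ∈ U)
    (hunit : ∀ s ∈ I, L (c s, deriv c s) = 1)
    -- the p-orthogonal fields v_I
    (v : Fin D → Vec n × Vec n → Vec n)
    (hvp : ∀ z ∈ U, ∀ i : Fin D, ∑ μ, pdy μ L z * v i z μ = 0)
    -- the decomposition of the auto-parallel deviation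
    (ξ₀ : ℝ → ℝ) (ξ : Fin D → ℝ → ℝ)
    (hflow : ∀ s ∈ I, ∀ μ,
      deriv (deriv c) s μ + 2 * G (c s, deriv c s) μ
        = ξ₀ s * deriv c s μ + ∑ i, ξ i s * v i (c s, deriv c s) μ) :
    ∀ s ∈ I, ξ₀ s = 0 := by
  intro s hs
  have hIo : IsOpen I := hI ▸ isOpen_Ioo
  have hz := hcU s hs
  have hLd : HasFDerivAt L (fderiv ℝ L (c s, deriv c s)) (c s, deriv c s) :=
    ((hLsmooth.contDiffAt (hUopen.mem_nhds hz)).differentiableAt (by simp)).hasFDerivAt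
  have hcd : HasDerivAt c (deriv c s) s :=
    ((hc.contDiffAt (hIo.mem_nhds hs)).differentiableAt (by simp)).hasDerivAt
  have hc2 : ContDiffOn ℝ 1 (deriv c) I := by
    refine (hc.of_le (m := 2) ?_).deriv_of_isOpen hIo ?_
    · exact WithTop.coe_le_coe.2 (le_top : (2 : ℕ∞) ≤ ⊤)
    · norm_num
  have hcdd : HasDerivAt (deriv c) (deriv (deriv c) s) s :=
    ((hc2.contDiffAt (hIo.mem_nhds hs)).differentiableAt (by simp)).hasDerivAt
  -- differentiate the arc-length condition
  have h1 : fderiv ℝ L (c s, deriv c s) (deriv c s, deriv (deriv c) s) = 0 := by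
    have h := hLd.comp_hasDerivAt s (hcd.prodMk hcdd)
    refine h.unique ((hasDerivAt_const s (1 : ℝ)).congr_of_eventuallyEq ?_)
    filter_upwards [hIo.mem_nhds hs] with t ht
    exact hunit t ht
  -- Euler's identity
  have h2 : fderiv ℝ L (c s, deriv c s) (0, deriv c s) = 1 := by
    have hg : HasDerivAt (fun t : ℝ => (c s, t • deriv c s)) (0, deriv c s) 1 := by
      have h := ((hasDerivAt_id (1 : ℝ)).smul_const (deriv c s))
      rw [one_smul] at h
      exact (hasDerivAt_const (1 : ℝ) (c s)).prodMk h
    have hLd' : HasFDerivAt L (fderiv ℝ L (c s, deriv c s)) (c s, (1 : ℝ) • deriv c s) := by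
      rw [one_smul]; exact hLd
    have h := hLd'.comp_hasDerivAt (1 : ℝ) hg
    refine h.unique ((hasDerivAt_id (1 : ℝ)).congr_of_eventuallyEq ?_)
    filter_upwards [lt_mem_nhds (zero_lt_one (α := ℝ))] with t ht
    have := hLhom _ hz t ht
    simp only [hunit s hs, mul_one] at this
    exact this
  rw [fderiv_expand] at h1 h2
  have h3 := hGid _ hz
  simp only at h3
  have h4 : ∑ μ, deriv (deriv c) s μ * pdy μ L (c s, deriv c s)
      + 2 * ∑ μ, pdy μ L (c s, deriv c s) * G (c s, deriv c s) μ
      = ξ₀ s * ∑ μ, deriv c s μ * pdy μ L (c s, deriv c s)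
        + ∑ i, ξ i s * ∑ μ, pdy μ L (c s, deriv c s) * v i (c s, deriv c s) μ := by
    have e : ∑ i, ξ i s * ∑ μ, pdy μ L (c s, deriv c s) * v i (c s, deriv c s) μ
        = ∑ μ, pdy μ L (c s, deriv c s) * ∑ i, ξ i s * v i (c s, deriv c s) μ := by
      simp only [Finset.mul_sum]
      rw [Finset.sum_comm]
      refine Finset.sum_congr rfl fun μ _ => Finset.sum_congr rfl fun i _ => by ring
    rw [e, Finset.mul_sum, Finset.mul_sum, ← Finset.sum_add_distrib, ← Finset.sum_add_distrib]
    refine Finset.sum_congr rfl fun μ _ => ?_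
    linear_combination pdy μ L (c s, deriv c s) * hflow s hs μ
  simp only [hvp _ hz, mul_zero, Finset.sum_const_zero, add_zero] at h4
  simp only [Pi.zero_apply, zero_mul, Finset.sum_const_zero, zero_add] at h2
  rw [h2] at h4
  linarith
end
end

section
/- Let V ⊆ ℝ^{n+1} be open, g : V → M_{n+1}(ℝ) a smooth Riemannian metric, and L(x,y) := √(Σ_{μ,ν} g_{μν}(x) y^μ y^ν) on V × (ℝ^{n+1} \ {0}). Write y_μ := Σ_ν g_{μν} y^ν. Then (a) the y-Hessian of L is L_{μν} = (1/L)(g_{μν} − y_μ y_ν / L²); and (b) at every point with y⁰ ≠ 0, the n×n submatrix (L_{ab})_{a,b=1,…,n} is invertible with inverse L^{ab} = L·(g^{ab} − g^{0a} y^b / y⁰ − g^{0b} y^a / y⁰ + g^{00} y^a y^b / (y⁰)²). -/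
open scoped BigOperators

noncomputable section

/-- The Riemannian Finsler metric `L(x,y) = √(Σ g_{μν}(x) y^μ y^ν)`. -/
def Lriem {n : ℕ} (g : Vec n → Matrix (Fin (n + 1)) (Fin (n + 1)) ℝ)
    (z : Vec n × Vec n) : ℝ :=
  Real.sqrt (∑ μ, ∑ ν, g z.1 μ ν * z.2 μ * z.2 ν)

/-- The `n × n` submatrix `(L_{ab})_{a,b=1,…,n}` of the `y`-Hessian of `L`. -/
def Lsub {n : ℕ} (g : Vec n → Matrix (Fin (n + 1)) (Fin (n + 1)) ℝ)
    (z : Vec n × Vec n) : Matrix (Fin n) (Fin n) ℝ :=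
  Matrix.of fun a b => pdy a.succ (pdy b.succ (Lriem g)) z

/-- The claimed inverse
`L^{ab} = L(g^{ab} − g^{0a} y^b/y⁰ − g^{0b} y^a/y⁰ + g^{00} y^a y^b/(y⁰)²)`. -/
def LsubInv {n : ℕ} (g : Vec n → Matrix (Fin (n + 1)) (Fin (n + 1)) ℝ)
    (z : Vec n × Vec n) : Matrix (Fin n) (Fin n) ℝ :=
  Matrix.of fun a b => Lriem g z *
    ((g z.1)⁻¹ a.succ b.succ
      - (g z.1)⁻¹ 0 a.succ * z.2 b.succ / z.2 0
      - (g z.1)⁻¹ 0 b.succ * z.2 a.succ / z.2 0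
      + (g z.1)⁻¹ 0 0 * z.2 a.succ * z.2 b.succ / (z.2 0) ^ 2)


/-- The quadratic form. -/
def Qf {n : ℕ} (g : Vec n → Matrix (Fin (n + 1)) (Fin (n + 1)) ℝ) (z : Vec n × Vec n) : ℝ :=
  ∑ μ, ∑ ν, g z.1 μ ν * z.2 μ * z.2 ν

/-- Lowered index. -/
def Nf {n : ℕ} (g : Vec n → Matrix (Fin (n + 1)) (Fin (n + 1)) ℝ) (ν : Fin (n + 1))
    (z : Vec n × Vec n) : ℝ := ∑ ρ, g z.1 ν ρ * z.2 ρ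

lemma hasDerivAt_line {n : ℕ} {f : Vec n × Vec n → ℝ} {z : Vec n × Vec n}
    (hf : DifferentiableAt ℝ f z) (μ : Fin (n + 1)) :
    HasDerivAt (fun t : ℝ => f (z.1, z.2 + t • Pi.single μ 1)) (pdy μ f z) 0 := by
  have h1 := hf.hasFDerivAt.hasLineDerivAt (0, Pi.single μ 1)
  unfold HasLineDerivAt at h1
  have e : (fun t : ℝ => f (z + t • ((0 : Vec n), (Pi.single μ 1 : Vec n))))
      = (fun t : ℝ => f (z.1, z.2 + t • Pi.single μ 1)) := by
    funext t
    congr 1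
    ext <;> simp
  rw [e] at h1
  exact h1

lemma hasDerivAt_coord {n : ℕ} (y : Vec n) (μ ρ : Fin (n + 1)) :
    HasDerivAt (fun t : ℝ => (y + t • (Pi.single μ 1 : Vec n)) ρ)
      ((Pi.single μ 1 : Vec n) ρ) 0 := by
  have h := ((hasDerivAt_id (0 : ℝ)).mul_const ((Pi.single μ 1 : Vec n) ρ)).const_add (y ρ)
  simpa using h

lemma pdy_Nf {n : ℕ} {g : Vec n → Matrix (Fin (n + 1)) (Fin (n + 1)) ℝ} {z : Vec n × Vec n}
    (ν μ : Fin (n + 1)) (hf : DifferentiableAt ℝ (Nf g ν) z) :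
    pdy μ (Nf g ν) z = g z.1 ν μ := by
  refine (hasDerivAt_line hf μ).unique ?_
  have h : HasDerivAt (fun t : ℝ => Nf g ν (z.1, z.2 + t • Pi.single μ 1))
      (∑ ρ, g z.1 ν ρ * (Pi.single μ 1 : Vec n) ρ) 0 :=
    HasDerivAt.fun_sum fun ρ _ => (hasDerivAt_coord z.2 μ ρ).const_mul (g z.1 ν ρ)
  simpa [Pi.single_apply] using h

lemma pdy_Qf {n : ℕ} {g : Vec n → Matrix (Fin (n + 1)) (Fin (n + 1)) ℝ} {z : Vec n × Vec n}
    (μ : Fin (n + 1)) (hf : DifferentiableAt ℝ (Qf g) z) (hs : ∀ i j, g z.1 i j = g z.1 j i) :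
    pdy μ (Qf g) z = 2 * Nf g μ z := by
  refine (hasDerivAt_line hf μ).unique ?_
  have h : HasDerivAt (fun t : ℝ => Qf g (z.1, z.2 + t • Pi.single μ 1))
      (∑ i, ∑ j, (g z.1 i j * (Pi.single μ 1 : Vec n) i * (z.2 + (0 : ℝ) • (Pi.single μ 1 : Vec n)) j
        + g z.1 i j * (z.2 + (0 : ℝ) • (Pi.single μ 1 : Vec n)) i * (Pi.single μ 1 : Vec n) j)) 0 :=
    HasDerivAt.fun_sum fun i _ => HasDerivAt.fun_sum fun j _ =>
      ((hasDerivAt_coord z.2 μ i).const_mul (g z.1 i j)).mul (hasDerivAt_coord z.2 μ j)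
  refine h.congr_deriv ?_
  simp only [zero_smul, add_zero, Finset.sum_add_distrib, Nf, two_mul]
  congr 1
  · rw [Finset.sum_comm]
    simp [Pi.single_apply]
  · simp [Pi.single_apply, hs μ]

lemma Qf_pos {n : ℕ} {g : Vec n → Matrix (Fin (n + 1)) (Fin (n + 1)) ℝ} {z : Vec n × Vec n}
    (hp : (g z.1).PosDef) (hz : z.2 ≠ 0) : 0 < Qf g z := by
  have h := hp.dotProduct_mulVec_pos hz
  have e : Qf g z = star z.2 ⬝ᵥ (g z.1).mulVec z.2 := by
    simp only [Qf, dotProduct, Matrix.mulVec, Finset.mul_sum, Pi.star_apply, star_trivial]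
    refine Finset.sum_congr rfl fun i _ => Finset.sum_congr rfl fun j _ => by ring
  rw [e]; exact h

lemma pd_symm {m : ℕ} {G : Matrix (Fin m) (Fin m) ℝ} (h : G.PosDef) (i j : Fin m) :
    G i j = G j i := by
  have := h.isHermitian.apply i j
  simpa using this.symm

lemma inverse_algebra {n : ℕ} (G H : Matrix (Fin (n + 1)) (Fin (n + 1)) ℝ) (y N : Vec n) (L : ℝ)
    (hGH : G * H = 1) (hs : ∀ i j, G i j = G j i) (hH : ∀ i j, H i j = H j i)
    (hN : ∀ i, N i = ∑ j, G i j * y j) (hL : L ≠ 0) (hLN : L ^ 2 = ∑ i, N i * y i)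
    (hy : y 0 ≠ 0) (a c : Fin n) :
    ∑ b : Fin n, (1 / L * (G a.succ b.succ - N a.succ * N b.succ / L ^ 2)) *
      (L * (H b.succ c.succ - H 0 b.succ * y c.succ / y 0 - H 0 c.succ * y b.succ / y 0
        + H 0 0 * y b.succ * y c.succ / (y 0) ^ 2)) = if a = c then 1 else 0 := by
  have hGHe : ∀ i k, ∑ j, G i j * H j k = if i = k then 1 else 0 := by
    intro i k
    have := congrFun (congrFun hGH i) k
    rwa [Matrix.mul_apply, Matrix.one_apply] at this
  have hNH : ∀ k, ∑ j, N j * H j k = y k := by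
    intro k
    simp only [hN, Finset.sum_mul]
    rw [Finset.sum_comm]
    calc ∑ i, ∑ j, G j i * y i * H j k = ∑ i, y i * ∑ j, G i j * H j k := by
          refine Finset.sum_congr rfl fun i _ => ?_
          rw [Finset.mul_sum]
          refine Finset.sum_congr rfl fun j _ => ?_
          rw [hs j i]; ring
      _ = y k := by simp [hGHe]
  set B : Fin (n + 1) → ℝ := fun j => H j c.succ - H j 0 * y c.succ / y 0
    - H 0 c.succ * y j / y 0 + H 0 0 * y j * y c.succ / (y 0) ^ 2 with hB
  have hB0 : B 0 = 0 := by simp only [hB]; field_simp; ring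
  have key : ∀ u : Vec n, ∑ j, u j * B j = ∑ j, u j * H j c.succ
      - (∑ j, u j * H j 0) * (y c.succ / y 0) - (∑ j, u j * y j) * (H 0 c.succ / y 0)
      + (∑ j, u j * y j) * (H 0 0 * y c.succ / (y 0) ^ 2) := by
    intro u
    simp only [Finset.sum_mul, ← Finset.sum_sub_distrib, ← Finset.sum_add_distrib]
    refine Finset.sum_congr rfl fun j _ => ?_
    simp only [hB]; ring
  have h1 := key (fun j => G a.succ j)
  have h2 := key N
  simp only [hGHe, hNH, ← hN, ← hLN] at h1 h2
  have hl : ∑ b : Fin n, (1 / L * (G a.succ b.succ - N a.succ * N b.succ / L ^ 2)) *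
      (L * (H b.succ c.succ - H 0 b.succ * y c.succ / y 0 - H 0 c.succ * y b.succ / y 0
        + H 0 0 * y b.succ * y c.succ / (y 0) ^ 2))
      = ∑ j, G a.succ j * B j - N a.succ / L ^ 2 * ∑ j, N j * B j := by
    rw [Fin.sum_univ_succ, Fin.sum_univ_succ (fun j => N j * B j), hB0, mul_zero, mul_zero,
      zero_add, zero_add, Finset.mul_sum, ← Finset.sum_sub_distrib]
    refine Finset.sum_congr rfl fun b _ => ?_
    simp only [hB, hH 0 b.succ]
    field_simp
  rw [hl, h1, h2]
  simp only [Fin.succ_inj, Fin.succ_ne_zero, if_false]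
  split_ifs <;> field_simp <;> ring

/-- For the Riemannian Finsler metric `L = √(g_{μν} y^μ y^ν)`:
(a) `L_{μν} = (1/L)(g_{μν} − y_μ y_ν/L²)` where `y_μ = g_{μν} y^ν`; (b) at points with
`y⁰ ≠ 0` the submatrix `(L_{ab})_{a,b=1,…,n}` is invertible with the explicit inverse. -/
theorem statement11 {n : ℕ} (hn : 1 ≤ n)
    (V : Set (Vec n)) (hVopen : IsOpen V)
    (g : Vec n → Matrix (Fin (n + 1)) (Fin (n + 1)) ℝ)
    (hgsmooth : ∀ μ ν, ContDiffOn ℝ (⊤ : ℕ∞) (fun x => g x μ ν) V)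
    (hgpos : ∀ x ∈ V, (g x).PosDef) :
    -- (a)
    (∀ z ∈ V ×ˢ {y : Vec n | y ≠ 0}, ∀ μ ν : Fin (n + 1),
      pdy μ (pdy ν (Lriem g)) z
        = 1 / Lriem g z * (g z.1 μ ν
            - (∑ ρ, g z.1 μ ρ * z.2 ρ) * (∑ ρ, g z.1 ν ρ * z.2 ρ) / (Lriem g z) ^ 2)) ∧
    -- (b)
    (∀ z ∈ V ×ˢ {y : Vec n | y ≠ 0}, z.2 0 ≠ 0 →
      Lsub g z * LsubInv g z = 1 ∧ LsubInv g z * Lsub g z = 1) := by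
  have hVn : ∀ x ∈ V, ∀ i j, DifferentiableAt ℝ (fun x => g x i j) x := fun x hx i j =>
    ((hgsmooth i j).contDiffAt (hVopen.mem_nhds hx)).differentiableAt (by simp)
  have hgz : ∀ z : Vec n × Vec n, z.1 ∈ V → ∀ i j,
      DifferentiableAt ℝ (fun z : Vec n × Vec n => g z.1 i j) z := fun z hz i j =>
    (hVn z.1 hz i j).comp z differentiableAt_fst
  have hyz : ∀ z : Vec n × Vec n, ∀ i, DifferentiableAt ℝ (fun z : Vec n × Vec n => z.2 i) z :=
    fun z i => by fun_prop
  have hQd : ∀ z : Vec n × Vec n, z.1 ∈ V → DifferentiableAt ℝ (Qf g) z := fun z hz =>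
    DifferentiableAt.fun_sum fun i _ => DifferentiableAt.fun_sum fun j _ =>
      ((hgz z hz i j).mul (hyz z i)).mul (hyz z j)
  have hNd : ∀ z : Vec n × Vec n, z.1 ∈ V → ∀ ν, DifferentiableAt ℝ (Nf g ν) z := fun z hz ν =>
    DifferentiableAt.fun_sum fun j _ => (hgz z hz ν j).mul (hyz z j)
  have hLQ : ∀ z, Lriem g z = Real.sqrt (Qf g z) := fun z => rfl
  have hLpos : ∀ z ∈ V ×ˢ {y : Vec n | y ≠ 0}, 0 < Lriem g z := fun z hz =>
    Real.sqrt_pos.2 (Qf_pos (hgpos _ hz.1) hz.2)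
  have hLd : ∀ z ∈ V ×ˢ {y : Vec n | y ≠ 0}, DifferentiableAt ℝ (Lriem g) z := fun z hz =>
    (hQd z hz.1).sqrt (Qf_pos (hgpos _ hz.1) hz.2).ne'
  have hpL : ∀ z ∈ V ×ˢ {y : Vec n | y ≠ 0}, ∀ ν,
      pdy ν (Lriem g) z = Nf g ν z / Lriem g z := by
    intro z hz ν
    have hQ := hasDerivAt_line (hQd z hz.1) ν
    have h0 : Qf g (z.1, z.2 + (0 : ℝ) • Pi.single ν 1) = Qf g z := by simp
    have h := hQ.sqrt (by rw [h0]; exact (Qf_pos (hgpos _ hz.1) hz.2).ne')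
    rw [h0, pdy_Qf ν (hQd z hz.1) (pd_symm (hgpos _ hz.1)), ← hLQ] at h
    rw [(hasDerivAt_line (hLd z hz) ν).unique h]
    have := (hLpos z hz).ne'
    field_simp
  have hopen : IsOpen (V ×ˢ {y : Vec n | y ≠ 0}) := hVopen.prod isOpen_ne
  have ha : ∀ z ∈ V ×ˢ {y : Vec n | y ≠ 0}, ∀ μ ν : Fin (n + 1),
      pdy μ (pdy ν (Lriem g)) z
        = 1 / Lriem g z * (g z.1 μ ν - Nf g μ z * Nf g ν z / (Lriem g z) ^ 2) := by
    intro z hz μ ν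
    have hL0 := (hLpos z hz).ne'
    have hev : pdy ν (Lriem g) =ᶠ[nhds z] fun z => Nf g ν z / Lriem g z :=
      Filter.eventually_of_mem (hopen.mem_nhds hz) fun w hw => hpL w hw ν
    have e1 : pdy μ (pdy ν (Lriem g)) z = pdy μ (fun z => Nf g ν z / Lriem g z) z := by
      unfold pdy at hev ⊢
      rw [hev.fderiv_eq]
    have h0 : (z.1, z.2 + (0 : ℝ) • (Pi.single μ 1 : Vec n)) = z := by simp
    have hd : DifferentiableAt ℝ (fun z => Nf g ν z / Lriem g z) z :=
      by simpa only [div_eq_mul_inv] using (hNd z hz.1 ν).fun_mul ((hLd z hz).fun_inv hL0)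
    have h := (hasDerivAt_line (hNd z hz.1 ν) μ).fun_div (hasDerivAt_line (hLd z hz) μ)
      (by rw [h0]; exact hL0)
    rw [e1, (hasDerivAt_line hd μ).unique h, h0, pdy_Nf ν μ (hNd z hz.1 ν), hpL z hz,
      pd_symm (hgpos _ hz.1) ν μ]
    field_simp
  refine ⟨ha, ?_⟩
  intro z hz hy
  have hmul : Lsub g z * LsubInv g z = 1 := by
    have hp := hgpos _ hz.1
    ext a c
    rw [Matrix.mul_apply, Matrix.one_apply]
    simp only [Lsub, LsubInv, Matrix.of_apply, ha z hz]
    refine inverse_algebra (g z.1) (g z.1)⁻¹ z.2 (fun i => Nf g i z) (Lriem g z)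
      (Matrix.mul_nonsing_inv _ (hp.isUnit.map Matrix.detMonoidHom)) (pd_symm hp)
      (pd_symm hp.inv) (fun i => rfl) (hLpos z hz).ne' ?_ hy a c
    rw [hLQ, Real.sq_sqrt (Qf_pos hp hz.2).le]
    simp only [Qf, Nf, Finset.sum_mul]
    refine Finset.sum_congr rfl fun i _ => Finset.sum_congr rfl fun j _ => by ring
  exact ⟨hmul, mul_eq_one_comm.1 hmul⟩
end
end

section
/- (Regular case: existence and uniqueness.) Let L be a Finsler metric on U with L(x,y) ≠ 0 on U, and suppose L is regular with respect to the index 0 in the sense that at every point of U the n×n submatrix (L_{ab})_{a,b=1,…,n} is invertible, with inverse (L^{ab}). Then there is exactly one non-linear Finsler connection N for L, and it is given by N^μ_α := ∂G^μ/∂y^α where G^μ := ½(Σ_β y^β ∂L/∂x^β)(y^μ/L) + Σ_{a,b} L^{ab} M_b (δ^μ_a − p_a y^μ/L) and M_μ := ½(−∂L/∂x^μ + Σ_ρ y^ρ ∂²L/∂y^μ∂x^ρ). -/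
open scoped BigOperators

noncomputable section

/-- `G^μ := ½(Σ_β y^β ∂L/∂x^β)(y^μ/L) + Σ_{a,b} L^{ab} M_b (δ^μ_a − p_a y^μ/L)`
in the regular case (indices `a, b = 1,…,n`). -/
def Gstar {n : ℕ} (L : Vec n × Vec n → ℝ)
    (Linv : Vec n × Vec n → Matrix (Fin n) (Fin n) ℝ)
    (μ : Fin (n + 1)) (z : Vec n × Vec n) : ℝ :=
  (1 : ℝ) / 2 * (∑ β, z.2 β * pdx β L z) * (z.2 μ / L z)
    + ∑ a : Fin n, ∑ b : Fin n, Linv z a b * Mfun L b.succ z *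
        ((if μ = a.succ then (1 : ℝ) else 0) - pdy a.succ L z * z.2 μ / L z)

/-- `N^μ_α := ∂G^μ/∂y^α`. -/
def Nstar {n : ℕ} (L : Vec n × Vec n → ℝ)
    (Linv : Vec n × Vec n → Matrix (Fin n) (Fin n) ℝ)
    (μ α : Fin (n + 1)) (z : Vec n × Vec n) : ℝ :=
  pdy α (Gstar L Linv μ) z

/-- A non-linear Finsler connection for `L` on `U`: a smooth matrix-valued map,
positively 1-homogeneous in `y`, with symmetric `y`-derivative, preserving `L`. -/
def IsFinslerConn {n : ℕ} (U : Set (Vec n × Vec n)) (L : Vec n × Vec n → ℝ)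
    (N : Vec n × Vec n → Fin (n + 1) → Fin (n + 1) → ℝ) : Prop :=
  (∀ μ α, ContDiffOn ℝ (⊤ : ℕ∞) (fun z => N z μ α) U) ∧
  (∀ z ∈ U, ∀ lam : ℝ, 0 < lam → ∀ μ α, N (z.1, lam • z.2) μ α = lam * N z μ α) ∧
  (∀ z ∈ U, ∀ μ α β, pdy β (fun w => N w μ α) z = pdy α (fun w => N w μ β) z) ∧
  (∀ z ∈ U, ∀ μ, pdx μ L z = ∑ α, pdy α L z * N z α μ)

section helpers

variable {n : ℕ} {U : Set (Vec n × Vec n)}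

lemma sm_diffAt (hU : IsOpen U) {f : Vec n × Vec n → ℝ} (hf : ContDiffOn ℝ (⊤ : ℕ∞) f U)
    {z : Vec n × Vec n} (hz : z ∈ U) : DifferentiableAt ℝ f z :=
  (hf.contDiffAt (hU.mem_nhds hz)).differentiableAt (by simp)

lemma sm_fderiv_apply (hU : IsOpen U) {f : Vec n × Vec n → ℝ}
    (hf : ContDiffOn ℝ (⊤ : ℕ∞) f U) (v : Vec n × Vec n) :
    ContDiffOn ℝ (⊤ : ℕ∞) (fun z => fderiv ℝ f z v) U :=
  (hf.fderiv_of_isOpen hU (m := (⊤ : ℕ∞)) (by exact_mod_cast le_refl _)).clm_apply contDiffOn_const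

lemma sm_pdx (hU : IsOpen U) {f : Vec n × Vec n → ℝ}
    (hf : ContDiffOn ℝ (⊤ : ℕ∞) f U) (μ : Fin (n + 1)) :
    ContDiffOn ℝ (⊤ : ℕ∞) (pdx μ f) U := sm_fderiv_apply hU hf _

lemma sm_pdy (hU : IsOpen U) {f : Vec n × Vec n → ℝ}
    (hf : ContDiffOn ℝ (⊤ : ℕ∞) f U) (μ : Fin (n + 1)) :
    ContDiffOn ℝ (⊤ : ℕ∞) (pdy μ f) U := sm_fderiv_apply hU hf _

lemma sm_coord (μ : Fin (n + 1)) :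
    ContDiffOn ℝ (⊤ : ℕ∞) (fun z : Vec n × Vec n => z.2 μ) U := by
  have : ContDiff ℝ (⊤ : ℕ∞) (fun z : Vec n × Vec n => z.2 μ) := by fun_prop
  exact this.contDiffOn

lemma pdy_symm (hU : IsOpen U) {f : Vec n × Vec n → ℝ}
    (hf : ContDiffOn ℝ (⊤ : ℕ∞) f U) {z : Vec n × Vec n} (hz : z ∈ U) (a b : Fin (n + 1)) :
    pdy a (pdy b f) z = pdy b (pdy a f) z := by
  have h2 : DifferentiableAt ℝ (fderiv ℝ f) z :=
    ((hf.fderiv_of_isOpen hU (m := (⊤ : ℕ∞)) (by exact_mod_cast le_refl _)).contDiffAt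
      (hU.mem_nhds hz)).differentiableAt (by simp)
  have key : ∀ u v : Vec n × Vec n, fderiv ℝ (fun w => fderiv ℝ f w v) z u
      = fderiv ℝ (fderiv ℝ f) z u v := by
    intro u v
    rw [fderiv_clm_apply h2 (differentiableAt_const v)]
    simp
  have hs : IsSymmSndFDerivAt ℝ f z :=
    (hf.contDiffAt (hU.mem_nhds hz)).isSymmSndFDerivAt (by simp; exact WithTop.coe_le_coe.2 (le_top : (2 : ℕ∞) ≤ ⊤))
  have e1 := key (0, Pi.single a 1) (0, Pi.single b 1)
  have e2 := key (0, Pi.single b 1) (0, Pi.single a 1)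
  exact e1.trans ((hs _ _).trans e2.symm)

lemma pdy_congr (hU : IsOpen U) {f g : Vec n × Vec n → ℝ} (h : ∀ z ∈ U, f z = g z)
    {z : Vec n × Vec n} (hz : z ∈ U) (a : Fin (n + 1)) : pdy a f z = pdy a g z := by
  have : f =ᶠ[nhds z] g := by
    filter_upwards [hU.mem_nhds hz] with w hw using h w hw
  unfold pdy
  rw [this.fderiv_eq]

lemma pdy_mul {f g : Vec n × Vec n → ℝ} {z : Vec n × Vec n}
    (hf : DifferentiableAt ℝ f z) (hg : DifferentiableAt ℝ g z) (a : Fin (n + 1)) :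
    pdy a (fun w => f w * g w) z = pdy a f z * g z + f z * pdy a g z := by
  unfold pdy
  rw [fderiv_fun_mul hf hg]
  simp
  ring

lemma pdy_const_mul {f : Vec n × Vec n → ℝ} {z : Vec n × Vec n}
    (hf : DifferentiableAt ℝ f z) (c : ℝ) (a : Fin (n + 1)) :
    pdy a (fun w => c * f w) z = c * pdy a f z := by
  unfold pdy
  rw [fderiv_const_mul hf]
  simp

lemma pdy_sum {ι : Type} [Fintype ι] {f : ι → Vec n × Vec n → ℝ} {z : Vec n × Vec n}
    (hf : ∀ i, DifferentiableAt ℝ (f i) z) (a : Fin (n + 1)) :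
    pdy a (fun w => ∑ i, f i w) z = ∑ i, pdy a (f i) z := by
  unfold pdy
  rw [fderiv_fun_sum (fun i _ => hf i)]
  simp

lemma pdy_coord (a b : Fin (n + 1)) (z : Vec n × Vec n) :
    pdy a (fun w : Vec n × Vec n => w.2 b) z = if b = a then 1 else 0 := by
  unfold pdy
  have : HasFDerivAt (fun w : Vec n × Vec n => w.2 b)
      ((ContinuousLinearMap.proj b).comp (ContinuousLinearMap.snd ℝ (Vec n) (Vec n))) z :=
    ((ContinuousLinearMap.proj (R := ℝ) (φ := fun _ : Fin (n+1) => ℝ) b).comp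
      (ContinuousLinearMap.snd ℝ (Vec n) (Vec n))).hasFDerivAt
  rw [this.fderiv]
  simp [Pi.single_apply]

/-- The fibre scaling map. -/
def scal (n : ℕ) (lam : ℝ) : (Vec n × Vec n) →L[ℝ] (Vec n × Vec n) :=
  (ContinuousLinearMap.fst ℝ (Vec n) (Vec n)).prod (lam • ContinuousLinearMap.snd ℝ (Vec n) (Vec n))

lemma fderiv_scal (hU : IsOpen U) {f : Vec n × Vec n → ℝ} (hf : ContDiffOn ℝ (⊤ : ℕ∞) f U)
    {lam c : ℝ} (h : ∀ z ∈ U, f (z.1, lam • z.2) = c * f z)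
    {z : Vec n × Vec n} (hz : z ∈ U) (hz' : (z.1, lam • z.2) ∈ U) (v : Vec n × Vec n) :
    fderiv ℝ f (z.1, lam • z.2) (v.1, lam • v.2) = c * fderiv ℝ f z v := by
  have h1 : HasFDerivAt f (fderiv ℝ f (z.1, lam • z.2)) (scal n lam z) :=
    (sm_diffAt hU hf hz').hasFDerivAt
  have h2 := h1.comp z (scal n lam).hasFDerivAt
  have h3 : HasFDerivAt (fun w => c * f w) (c • fderiv ℝ f z) z :=
    (sm_diffAt hU hf hz).hasFDerivAt.const_mul c
  have h4 : (f ∘ (scal n lam)) =ᶠ[nhds z] (fun w => c * f w) := by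
    filter_upwards [hU.mem_nhds hz] with w hw using h w hw
  have h5 := (h3.congr_of_eventuallyEq h4).unique h2
  have h6 := congrArg (fun T => T v) h5
  simpa [scal] using h6.symm

lemma pdy_hom (hU : IsOpen U) {f : Vec n × Vec n → ℝ} (hf : ContDiffOn ℝ (⊤ : ℕ∞) f U)
    {lam c : ℝ} (h : ∀ z ∈ U, f (z.1, lam • z.2) = c * f z)
    {z : Vec n × Vec n} (hz : z ∈ U) (hz' : (z.1, lam • z.2) ∈ U) (a : Fin (n + 1)) :
    lam * pdy a f (z.1, lam • z.2) = c * pdy a f z := by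
  have := fderiv_scal hU hf h hz hz' (0, Pi.single a 1)
  unfold pdy
  rw [← this, ← smul_eq_mul, ← map_smul]
  simp

lemma pdx_hom (hU : IsOpen U) {f : Vec n × Vec n → ℝ} (hf : ContDiffOn ℝ (⊤ : ℕ∞) f U)
    {lam c : ℝ} (h : ∀ z ∈ U, f (z.1, lam • z.2) = c * f z)
    {z : Vec n × Vec n} (hz : z ∈ U) (hz' : (z.1, lam • z.2) ∈ U) (a : Fin (n + 1)) :
    pdx a f (z.1, lam • z.2) = c * pdx a f z := by
  have := fderiv_scal hU hf h hz hz' (Pi.single a 1, 0)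
  unfold pdx
  rw [← this]
  simp

lemma euler (hU : IsOpen U) {f : Vec n × Vec n → ℝ} (hf : ContDiffOn ℝ (⊤ : ℕ∞) f U)
    {z : Vec n × Vec n} (hz : z ∈ U) (k : ℕ)
    (h : ∀ lam : ℝ, 0 < lam → f (z.1, lam • z.2) = lam ^ k * f z) :
    ∑ μ, z.2 μ * pdy μ f z = k * f z := by
  have hz1 : (z.1, (1 : ℝ) • z.2) = z := by simp
  have h1 : HasFDerivAt f (fderiv ℝ f z) (z.1, (1 : ℝ) • z.2) := by
    rw [hz1]; exact (sm_diffAt hU hf hz).hasFDerivAt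
  have hc : HasDerivAt (fun t : ℝ => (z.1, t • z.2)) ((0 : Vec n), (1 : ℝ) • z.2) 1 :=
    (hasDerivAt_const (1 : ℝ) z.1).prodMk ((hasDerivAt_id (1 : ℝ)).smul_const z.2)
  have h2 := h1.comp_hasDerivAt (1 : ℝ) hc
  have h3 : HasDerivAt (fun t : ℝ => t ^ k * f z) ((k * 1 ^ (k - 1)) * f z) 1 :=
    (hasDerivAt_pow k (1 : ℝ)).mul_const (f z)
  have h4 : (f ∘ fun t : ℝ => (z.1, t • z.2)) =ᶠ[nhds 1] (fun t : ℝ => t ^ k * f z) := by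
    filter_upwards [lt_mem_nhds (zero_lt_one : (0 : ℝ) < 1)] with t ht using h t ht
  have h5 := (h3.congr_of_eventuallyEq h4).unique h2
  have h6 : ((0 : Vec n), (1 : ℝ) • z.2) = ∑ μ, z.2 μ • ((0 : Vec n), Pi.single μ (1 : ℝ)) := by
    ext i
    · simp [Prod.fst_sum]
    · simp [Prod.snd_sum, Pi.single_apply]
  rw [h6, map_sum] at h5
  simp only [map_smul, smul_eq_mul, one_pow, mul_one] at h5
  exact h5.symm

lemma sm_det {m : ℕ} {A : Vec n × Vec n → Matrix (Fin m) (Fin m) ℝ}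
    (hA : ∀ i j, ContDiffOn ℝ (⊤ : ℕ∞) (fun z => A z i j) U) :
    ContDiffOn ℝ (⊤ : ℕ∞) (fun z => (A z).det) U := by
  simp only [Matrix.det_apply']
  exact ContDiffOn.sum fun σ _ => contDiffOn_const.mul (contDiffOn_prod fun i _ => hA _ _)

lemma sm_inv {m : ℕ} {A B : Vec n × Vec n → Matrix (Fin m) (Fin m) ℝ}
    (hA : ∀ i j, ContDiffOn ℝ (⊤ : ℕ∞) (fun z => A z i j) U)
    (hAB : ∀ z ∈ U, A z * B z = 1) (i j : Fin m) :
    ContDiffOn ℝ (⊤ : ℕ∞) (fun z => B z i j) U := by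
  have hdet : ∀ z ∈ U, (A z).det ≠ 0 := by
    intro z hz h0
    have := congrArg Matrix.det (hAB z hz)
    rw [Matrix.det_mul, h0] at this
    simp at this
  have hadj : ContDiffOn ℝ (⊤ : ℕ∞) (fun z => (A z).adjugate i j) U := by
    simp only [Matrix.adjugate_apply]
    apply sm_det
    intro k l
    by_cases hk : k = j
    · subst hk
      simp only [Matrix.updateRow_self]
      exact contDiffOn_const
    · simp only [Matrix.updateRow_ne hk]
      exact hA k l
  refine (((sm_det hA).inv hdet).mul hadj).congr ?_
  intro z hz
  have e : (A z)⁻¹ = B z := Matrix.inv_eq_right_inv (hAB z hz)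
  rw [← e, Matrix.inv_def]
  simp

end helpers

/-- Regular case: existence and uniqueness: If the submatrix
`(L_{ab})_{a,b=1,…,n}` of the `y`-Hessian of a nowhere-vanishing Finsler metric `L` is
invertible with inverse `(L^{ab})`, there is exactly one non-linear Finsler connection
for `L`, namely `N^μ_α = ∂G^μ/∂y^α` with the explicit `G^μ` above. -/
theorem statement12 {n : ℕ} (hn : 1 ≤ n)
    (U : Set (Vec n × Vec n)) (hUopen : IsOpen U)
    (hUslit : ∀ z ∈ U, z.2 ≠ 0)
    (hconic : ∀ z ∈ U, ∀ lam : ℝ, 0 < lam → (z.1, lam • z.2) ∈ U)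
    (L : Vec n × Vec n → ℝ)
    (hLsmooth : ContDiffOn ℝ (⊤ : ℕ∞) L U)
    (hLhom : ∀ z ∈ U, ∀ lam : ℝ, 0 < lam → L (z.1, lam • z.2) = lam * L z)
    (hLne : ∀ z ∈ U, L z ≠ 0)
    -- the inverse (L^{ab}) of the regular submatrix (L_{ab})
    (Linv : Vec n × Vec n → Matrix (Fin n) (Fin n) ℝ)
    (hLinv : ∀ z ∈ U, ∀ a b : Fin n,
      ∑ k, pdy a.succ (pdy k.succ L) z * Linv z k b = (if a = b then (1 : ℝ) else 0))
    (hLinv' : ∀ z ∈ U, ∀ a b : Fin n,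
      ∑ k, Linv z a k * pdy k.succ (pdy b.succ L) z = (if a = b then (1 : ℝ) else 0)) :
    IsFinslerConn U L (fun z μ α => Nstar L Linv μ α z) ∧
    (∀ N', IsFinslerConn U L N' →
      ∀ z ∈ U, ∀ μ α, N' z μ α = Nstar L Linv μ α z) := by
  have hpdy0 : ∀ ν, ∀ z ∈ U, ∀ lam : ℝ, 0 < lam →
      pdy ν L (z.1, lam • z.2) = pdy ν L z := by
    intro ν z hz lam hl
    have := pdy_hom hUopen hLsmooth (fun w hw => hLhom w hw lam hl) hz (hconic z hz lam hl) ν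
    exact mul_left_cancel₀ hl.ne' this
  have hpdx1 : ∀ ν, ∀ z ∈ U, ∀ lam : ℝ, 0 < lam →
      pdx ν L (z.1, lam • z.2) = lam * pdx ν L z := by
    intro ν z hz lam hl
    exact pdx_hom hUopen hLsmooth (fun w hw => hLhom w hw lam hl) hz (hconic z hz lam hl) ν
  have hsp : ∀ ν, ContDiffOn ℝ (⊤ : ℕ∞) (pdy ν L) U := sm_pdy hUopen hLsmooth
  have hsx : ∀ ν, ContDiffOn ℝ (⊤ : ℕ∞) (pdx ν L) U := sm_pdx hUopen hLsmooth
  have hHh : ∀ a b, ∀ z ∈ U, ∀ lam : ℝ, 0 < lam →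
      lam * pdy a (pdy b L) (z.1, lam • z.2) = pdy a (pdy b L) z := by
    intro a b z hz lam hl
    have := pdy_hom hUopen (hsp b) (c := 1)
      (fun w hw => by rw [hpdy0 b w hw lam hl, one_mul]) hz (hconic z hz lam hl) a
    rwa [one_mul] at this
  have hpxh : ∀ a b, ∀ z ∈ U, ∀ lam : ℝ, 0 < lam →
      pdy a (pdx b L) (z.1, lam • z.2) = pdy a (pdx b L) z := by
    intro a b z hz lam hl
    have := pdy_hom hUopen (hsx b)
      (fun w hw => hpdx1 b w hw lam hl) hz (hconic z hz lam hl) a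
    exact mul_left_cancel₀ hl.ne' this
  have eL : ∀ z ∈ U, ∑ μ, z.2 μ * pdy μ L z = L z := by
    intro z hz
    have := euler hUopen hLsmooth hz 1 (fun lam hl => by rw [hLhom z hz lam hl, pow_one])
    simpa using this
  have ep : ∀ z ∈ U, ∀ ν, ∑ μ, z.2 μ * pdy μ (pdy ν L) z = 0 := by
    intro z hz ν
    have := euler hUopen (hsp ν) hz 0 (fun lam hl => by rw [hpdy0 ν z hz lam hl, pow_zero, one_mul])
    simpa using this
  have ex : ∀ z ∈ U, ∀ ν, ∑ μ, z.2 μ * pdy μ (pdx ν L) z = pdx ν L z := by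
    intro z hz ν
    have := euler hUopen (hsx ν) hz 1 (fun lam hl => by rw [hpdx1 ν z hz lam hl, pow_one])
    simpa using this
  -- kernel
  have hker : ∀ z ∈ U, ∀ v : Fin n → ℝ,
      (∀ b : Fin n, ∑ k, v k * pdy k.succ (pdy b.succ L) z = 0) → ∀ c, v c = 0 := by
    intro z hz v hv c
    have h1 : ∑ b, (∑ k, v k * pdy k.succ (pdy b.succ L) z) * Linv z b c = 0 := by
      simp [hv]
    have h2 : ∑ b, (∑ k, v k * pdy k.succ (pdy b.succ L) z) * Linv z b c
        = ∑ k, v k * ∑ b, pdy k.succ (pdy b.succ L) z * Linv z b c := by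
      simp only [Finset.sum_mul, Finset.mul_sum]
      rw [Finset.sum_comm]
      simp only [mul_assoc]
    rw [h2] at h1
    simp only [hLinv z hz] at h1
    simpa using h1
  have hy0 : ∀ z ∈ U, z.2 0 ≠ 0 := by
    intro z hz h0
    apply hUslit z hz
    have h1 := hker z hz (fun k => z.2 k.succ) (by
      intro b
      have := ep z hz b.succ
      rw [Fin.sum_univ_succ, h0, zero_mul, zero_add] at this
      exact this)
    funext i
    refine Fin.cases h0 (fun k => h1 k) i
  have huniq : ∀ z ∈ U, ∀ D : Vec n, (∑ μ, pdy μ L z * D μ = 0) →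
      (∀ b : Fin n, ∑ α, D α * pdy α (pdy b.succ L) z = 0) → ∀ μ, D μ = 0 := by
    intro z hz D hD1 hD2
    have hy := hy0 z hz
    obtain ⟨c, hc⟩ : ∃ c, c * z.2 0 = D 0 := ⟨D 0 / z.2 0, div_mul_cancel₀ _ hy⟩
    have h1 := hker z hz (fun k => D k.succ - c * z.2 k.succ) (by
      intro b
      have e1 := ep z hz b.succ
      have e2 := hD2 b
      rw [Fin.sum_univ_succ] at e1 e2
      simp only [sub_mul, Finset.sum_sub_distrib, mul_assoc, ← Finset.mul_sum]
      rw [← hc] at e2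
      linear_combination e2 - c * e1)
    have h2 : ∀ μ, D μ = c * z.2 μ := by
      intro μ
      refine Fin.cases hc.symm (fun k => ?_) μ
      have := h1 k
      linarith
    have h3 : c * L z = 0 := by
      rw [← eL z hz, ← hD1, Finset.mul_sum]
      refine Finset.sum_congr rfl fun μ _ => ?_
      rw [h2 μ]; ring
    have h4 : c = 0 := by
      rcases mul_eq_zero.1 h3 with h | h
      · exact h
      · exact absurd h (hLne z hz)
    intro μ
    rw [h2, h4, zero_mul]
  -- the inverse matrix
  have hAB : ∀ z ∈ U, (Matrix.of fun a b : Fin n => pdy a.succ (pdy b.succ L) z) * Linv z = 1 := by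
    intro z hz
    ext a b
    rw [Matrix.mul_apply, Matrix.one_apply]
    exact hLinv z hz a b
  have hsInv : ∀ a b, ContDiffOn ℝ (⊤ : ℕ∞) (fun z => Linv z a b) U := by
    intro a b
    exact sm_inv (A := fun z => Matrix.of fun a b : Fin n => pdy a.succ (pdy b.succ L) z)
      (fun i j => sm_pdy hUopen (hsp j.succ) i.succ) hAB a b
  have hInvh : ∀ z ∈ U, ∀ lam : ℝ, 0 < lam → ∀ a b,
      Linv (z.1, lam • z.2) a b = lam * Linv z a b := by
    intro z hz lam hl a b
    have h1 := Matrix.inv_eq_right_inv (hAB _ (hconic z hz lam hl))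
    have h2 : (Matrix.of fun a b : Fin n => pdy a.succ (pdy b.succ L) (z.1, lam • z.2))
        * (lam • Linv z) = 1 := by
      rw [← hAB z hz]
      ext a b
      rw [Matrix.mul_apply, Matrix.mul_apply]
      refine Finset.sum_congr rfl fun k _ => ?_
      simp only [Matrix.of_apply, Matrix.smul_apply, smul_eq_mul]
      rw [← hHh a.succ k.succ z hz lam hl]
      ring
    have h3 := Matrix.inv_eq_right_inv h2
    rw [← h1, h3]
    rfl
  have hsM : ∀ μ, ContDiffOn ℝ (⊤ : ℕ∞) (Mfun L μ) U := by
    intro μ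
    unfold Mfun
    exact contDiffOn_const.mul ((hsx μ).neg.add
      (ContDiffOn.sum fun ρ _ => (sm_coord ρ).mul (sm_pdy hUopen (hsx ρ) μ)))
  have hMh : ∀ z ∈ U, ∀ lam : ℝ, 0 < lam → ∀ μ,
      Mfun L μ (z.1, lam • z.2) = lam * Mfun L μ z := by
    intro z hz lam hl μ
    unfold Mfun
    simp only [hpdx1 _ z hz lam hl, hpxh _ _ z hz lam hl, Pi.smul_apply, smul_eq_mul, mul_assoc,
      ← Finset.mul_sum]
    ring
  have hsA : ContDiffOn ℝ (⊤ : ℕ∞) (fun z => ∑ β, z.2 β * pdx β L z) U :=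
    ContDiffOn.sum fun ρ _ => (sm_coord ρ).mul (hsx ρ)
  have hsG : ∀ μ, ContDiffOn ℝ (⊤ : ℕ∞) (Gstar L Linv μ) U := by
    intro μ
    unfold Gstar
    refine ((contDiffOn_const.mul hsA).mul ((sm_coord μ).div hLsmooth hLne)).add
      (ContDiffOn.sum fun a _ => ContDiffOn.sum fun b _ =>
        ((hsInv a b).mul (hsM b.succ)).mul (contDiffOn_const.sub
          (((hsp a.succ).mul (sm_coord μ)).div hLsmooth hLne)))
  have hGh : ∀ z ∈ U, ∀ lam : ℝ, 0 < lam → ∀ μ,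
      Gstar L Linv μ (z.1, lam • z.2) = lam ^ 2 * Gstar L Linv μ z := by
    intro z hz lam hl μ
    unfold Gstar
    have hL0 := hLne z hz
    have hl0 := hl.ne'
    simp only [hpdx1 _ z hz lam hl, hMh z hz lam hl, hInvh z hz lam hl, hpdy0 _ z hz lam hl,
      hLhom z hz lam hl, Pi.smul_apply, smul_eq_mul]
    rw [mul_add]
    congr 1
    · have : ∑ x, lam * z.2 x * (lam * pdx x L z) = lam ^ 2 * ∑ x, z.2 x * pdx x L z := by
        rw [Finset.mul_sum]
        exact Finset.sum_congr rfl fun _ _ => by ring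
      rw [this]
      field_simp
    · rw [Finset.mul_sum]
      refine Finset.sum_congr rfl fun a _ => ?_
      rw [Finset.mul_sum]
      refine Finset.sum_congr rfl fun b _ => ?_
      have : pdy a.succ L z * (lam * z.2 μ) / (lam * L z) = pdy a.succ L z * z.2 μ / L z := by
        field_simp
      rw [this]
      ring
  have hGform : ∀ z ∈ U, ∃ (s : ℝ) (q : Fin n → ℝ),
      (∀ a, q a = ∑ b : Fin n, Linv z a b * Mfun L b.succ z) ∧
      s * L z + ∑ a, pdy a.succ L z * q a = 1 / 2 * ∑ β, z.2 β * pdx β L z ∧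
      Gstar L Linv 0 z = s * z.2 0 ∧ ∀ a : Fin n, Gstar L Linv a.succ z = s * z.2 a.succ + q a := by
    intro z hz
    have hL0 := hLne z hz
    set q : Fin n → ℝ := fun a => ∑ b : Fin n, Linv z a b * Mfun L b.succ z with hq
    set A := ∑ β, z.2 β * pdx β L z with hA
    have hG : ∀ μ, Gstar L Linv μ z = (1 / 2 * A - ∑ a, pdy a.succ L z * q a) / L z * z.2 μ
        + ∑ a : Fin n, q a * (if μ = a.succ then (1 : ℝ) else 0) := by
      intro μ
      unfold Gstar
      simp only [← Finset.sum_mul]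
      rw [← hA]
      simp only [mul_sub, Finset.sum_sub_distrib]
      have : ∑ a, q a * (pdy a.succ L z * z.2 μ / L z)
          = (∑ a, pdy a.succ L z * q a) / L z * z.2 μ := by
        rw [Finset.sum_div, Finset.sum_mul]
        exact Finset.sum_congr rfl fun _ _ => by ring
      rw [this]
      ring
    refine ⟨(1 / 2 * A - ∑ a, pdy a.succ L z * q a) / L z, q, fun a => rfl, ?_, ?_, ?_⟩
    · field_simp
      ring
    · rw [hG]
      simp [(Fin.succ_ne_zero _).symm]
    · intro a
      rw [hG]
      simp [Fin.succ_inj]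
  have hG1 : ∀ z ∈ U, ∑ μ, pdy μ L z * Gstar L Linv μ z = 1 / 2 * ∑ β, z.2 β * pdx β L z := by
    intro z hz
    obtain ⟨s, q, hq, hs, h0, ha⟩ := hGform z hz
    have e := eL z hz
    rw [Fin.sum_univ_succ] at e ⊢
    rw [h0]
    simp only [ha, mul_add, Finset.sum_add_distrib]
    rw [← hs, ← e, mul_add, Finset.mul_sum]
    have : ∑ x : Fin n, pdy x.succ L z * (s * z.2 x.succ)
        = ∑ i : Fin n, s * (z.2 i.succ * pdy i.succ L z) :=
      Finset.sum_congr rfl fun _ _ => by ring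
    rw [this]
    ring
  have hG2 : ∀ z ∈ U, ∀ b : Fin n,
      ∑ α, Gstar L Linv α z * pdy α (pdy b.succ L) z = Mfun L b.succ z := by
    intro z hz b
    obtain ⟨s, q, hq, hs, h0, ha⟩ := hGform z hz
    have e := ep z hz b.succ
    rw [Fin.sum_univ_succ] at e ⊢
    rw [h0]
    simp only [ha, add_mul, Finset.sum_add_distrib, mul_assoc, ← Finset.mul_sum]
    have h1 : ∑ a : Fin n, q a * pdy a.succ (pdy b.succ L) z
        = ∑ c, (∑ a, pdy b.succ (pdy a.succ L) z * Linv z a c) * Mfun L c.succ z := by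
      simp only [hq, Finset.sum_mul]
      rw [Finset.sum_comm]
      refine Finset.sum_congr rfl fun c _ => Finset.sum_congr rfl fun a _ => ?_
      rw [pdy_symm hUopen hLsmooth hz a.succ b.succ]
      ring
    rw [h1]
    simp only [hLinv z hz]
    simp only [ite_mul, one_mul, zero_mul, Finset.sum_ite_eq, Finset.mem_univ, if_true]
    linear_combination s * e
  have hG3 : ∀ z ∈ U, ∀ μ,
      ∑ α, Gstar L Linv α z * pdy α (pdy μ L) z = Mfun L μ z := by
    intro z hz μ
    refine Fin.cases ?_ (fun b => hG2 z hz b) μ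
    have hM : ∑ μ, z.2 μ * Mfun L μ z = 0 := by
      have h1 : ∑ μ, z.2 μ * Mfun L μ z = 1 / 2 * (-(∑ μ, z.2 μ * pdx μ L z)
          + ∑ ρ, z.2 ρ * ∑ μ, z.2 μ * pdy μ (pdx ρ L) z) := by
        unfold Mfun
        simp only [Finset.mul_sum, mul_add, Finset.sum_add_distrib, ← Finset.sum_neg_distrib]
        congr 1
        · exact Finset.sum_congr rfl fun _ _ => by ring
        · rw [Finset.sum_comm]
          exact Finset.sum_congr rfl fun _ _ => Finset.sum_congr rfl fun _ _ => by ring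
      rw [h1]
      simp only [ex z hz]
      ring
    have hK : ∑ μ, z.2 μ * ∑ α, Gstar L Linv α z * pdy α (pdy μ L) z = 0 := by
      have h1 : ∑ μ, z.2 μ * ∑ α, Gstar L Linv α z * pdy α (pdy μ L) z
          = ∑ α, Gstar L Linv α z * ∑ μ, z.2 μ * pdy μ (pdy α L) z := by
        simp only [Finset.mul_sum]
        rw [Finset.sum_comm]
        refine Finset.sum_congr rfl fun α _ => Finset.sum_congr rfl fun μ _ => ?_
        rw [pdy_symm hUopen hLsmooth hz α μ]
        ring
      rw [h1]
      simp [ep z hz]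
    rw [Fin.sum_univ_succ] at hM hK
    simp only [hG2 z hz] at hK
    exact mul_left_cancel₀ (hy0 z hz) (by linarith)
  have hdA : ∀ z ∈ U, ∀ μ, pdy μ (fun w => 1 / 2 * ∑ β, w.2 β * pdx β L w) z
      = 1 / 2 * (pdx μ L z + ∑ β, z.2 β * pdy μ (pdx β L) z) := by
    intro z hz μ
    rw [pdy_const_mul (sm_diffAt hUopen hsA hz),
      pdy_sum (fun β => sm_diffAt hUopen ((sm_coord β).mul (hsx β)) hz)]
    congr 1
    have : ∀ β, pdy μ (fun w => w.2 β * pdx β L w) z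
        = (if β = μ then 1 else 0) * pdx β L z + z.2 β * pdy μ (pdx β L) z := by
      intro β
      rw [pdy_mul (sm_diffAt hUopen (sm_coord β) hz) (sm_diffAt hUopen (hsx β) hz), pdy_coord]
    simp only [this, Finset.sum_add_distrib]
    simp
  refine ⟨⟨fun μ α => sm_pdy hUopen (hsG μ) α, ?_, ?_, ?_⟩, ?_⟩
  · intro z hz lam hl μ α
    have := pdy_hom hUopen (hsG μ) (fun w hw => hGh w hw lam hl μ) hz (hconic z hz lam hl) α
    refine mul_left_cancel₀ hl.ne' ?_
    unfold Nstar
    rw [this]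
    ring
  · intro z hz μ α β
    exact pdy_symm hUopen (hsG μ) hz β α
  · intro z hz μ
    have h1 := pdy_congr hUopen hG1 hz μ
    rw [hdA z hz, pdy_sum (fun β => sm_diffAt hUopen ((hsp β).mul (hsG β)) hz)] at h1
    simp only [pdy_mul (sm_diffAt hUopen (hsp _) hz) (sm_diffAt hUopen (hsG _) hz),
      Finset.sum_add_distrib] at h1
    have h2 : ∑ α, pdy μ (pdy α L) z * Gstar L Linv α z = Mfun L μ z := by
      rw [← hG3 z hz μ]
      refine Finset.sum_congr rfl fun α _ => ?_
      rw [pdy_symm hUopen hLsmooth hz α μ]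
      ring
    rw [h2] at h1
    unfold Mfun at h1
    unfold Nstar
    linarith
  · rintro N' ⟨hs, hh, hsym, hL⟩ z hz μ α
    have hsK : ∀ μ, ContDiffOn ℝ (⊤ : ℕ∞) (fun w => ∑ β, w.2 β * N' w μ β) U := fun μ =>
      ContDiffOn.sum fun β _ => (sm_coord β).mul (hs μ β)
    have eN : ∀ w ∈ U, ∀ μ α, ∑ β, w.2 β * pdy β (fun u => N' u μ α) w = N' w μ α := by
      intro w hw μ α
      have := euler hUopen (hs μ α) hw 1 (fun lam hl => by rw [hh w hw lam hl, pow_one])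
      simpa using this
    have hN : ∀ w ∈ U, ∀ μ α, pdy α (fun u => 1 / 2 * ∑ β, u.2 β * N' u μ β) w = N' w μ α := by
      intro w hw μ α
      rw [pdy_const_mul (sm_diffAt hUopen (hsK μ) hw),
        pdy_sum (fun β => sm_diffAt hUopen ((sm_coord β).mul (hs μ β)) hw)]
      have : ∀ β, pdy α (fun u => u.2 β * N' u μ β) w
          = (if β = α then 1 else 0) * N' w μ β + w.2 β * pdy β (fun u => N' u μ α) w := by
        intro β
        rw [pdy_mul (sm_diffAt hUopen (sm_coord β) hw) (sm_diffAt hUopen (hs μ β) hw), pdy_coord,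
          hsym w hw μ β α]
      simp only [this, Finset.sum_add_distrib, eN w hw]
      simp
      ring
    have hGeq : ∀ w ∈ U, ∀ μ, 1 / 2 * ∑ β, w.2 β * N' w μ β = Gstar L Linv μ w := by
      intro w hw μ
      have K1 : ∑ μ, pdy μ L w * (1 / 2 * ∑ β, w.2 β * N' w μ β)
          = 1 / 2 * ∑ β, w.2 β * pdx β L w := by
        simp only [hL w hw, Finset.mul_sum]
        rw [Finset.sum_comm]
        exact Finset.sum_congr rfl fun _ _ => Finset.sum_congr rfl fun _ _ => by ring
      have K2 : ∀ ν, ∑ α, (1 / 2 * ∑ β, w.2 β * N' w α β) * pdy α (pdy ν L) w = Mfun L ν w := by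
        intro ν
        have d : ∀ ρ, pdy ν (pdx ρ L) w = ∑ α, pdy α (pdy ν L) w * N' w α ρ
            + ∑ α, pdy α L w * pdy ρ (fun u => N' u α ν) w := by
          intro ρ
          rw [pdy_congr hUopen (fun u hu => hL u hu ρ) hw ν,
            pdy_sum (fun α => sm_diffAt hUopen ((hsp α).mul (hs α ρ)) hw),
            ← Finset.sum_add_distrib]
          refine Finset.sum_congr rfl fun α _ => ?_
          rw [pdy_mul (sm_diffAt hUopen (hsp α) hw) (sm_diffAt hUopen (hs α ρ) hw),
            pdy_symm hUopen hLsmooth hw ν α, hsym w hw α ρ ν]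
        have d2 : ∑ ρ, w.2 ρ * pdy ν (pdx ρ L) w
            = ∑ α, (∑ β, w.2 β * N' w α β) * pdy α (pdy ν L) w
              + ∑ α, pdy α L w * ∑ ρ, w.2 ρ * pdy ρ (fun u => N' u α ν) w := by
          simp only [d, mul_add, Finset.sum_add_distrib, Finset.mul_sum, Finset.sum_mul]
          congr 1
          · rw [Finset.sum_comm]
            exact Finset.sum_congr rfl fun _ _ => Finset.sum_congr rfl fun _ _ => by ring
          · rw [Finset.sum_comm]
            exact Finset.sum_congr rfl fun _ _ => Finset.sum_congr rfl fun _ _ => by ring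
        simp only [eN w hw] at d2
        rw [← hL w hw ν] at d2
        unfold Mfun
        rw [d2]
        simp only [mul_assoc, ← Finset.mul_sum]
        ring
      have := huniq w hw (fun μ => 1 / 2 * ∑ β, w.2 β * N' w μ β - Gstar L Linv μ w)
        (by
          simp only [mul_sub, Finset.sum_sub_distrib]
          rw [K1, hG1 w hw, sub_self])
        (by
          intro b
          simp only [sub_mul, Finset.sum_sub_distrib]
          rw [K2, hG2 w hw, sub_self]) μ
      exact sub_eq_zero.1 this
    rw [← hN z hz μ α]
    exact pdy_congr hUopen (fun w hw => hGeq w hw μ) hz α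
end
end

section
/- (Potential system reduces to Newton's equation.) Let m > 0 and let V : ℝ³ → ℝ be smooth. Define the Finsler metric L(x⁰,x¹,x²,x³; y⁰,y¹,y²,y³) := (m/2)((y¹)² + (y²)² + (y³)²)/y⁰ − V(x¹,x²,x³) y⁰ on U := ℝ⁴ × {y ∈ ℝ⁴ : y⁰ > 0}. Let q : I → ℝ³ be a smooth curve on an open interval I and consider the parameterised curve c(t) := (t, q¹(t), q²(t), q³(t)). Then c satisfies the Euler–Lagrange equations (d/dt)[(∂L/∂y^μ)(c(t),ċ(t))] = (∂L/∂x^μ)(c(t),ċ(t)) for all μ = 0,1,2,3 if and only if m q̈^a(t) = −(∂V/∂x^a)(q(t)) for all t ∈ I and a = 1,2,3. -/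
open scoped BigOperators

noncomputable section

def LL (m : ℝ) (V : (Fin 3 → ℝ) → ℝ) : Vec 3 × Vec 3 → ℝ := fun z =>
      m / 2 * ((z.2 1) ^ 2 + (z.2 2) ^ 2 + (z.2 3) ^ 2) / z.2 0
        - V (fun a => z.1 a.succ) * z.2 0

lemma LL_fderiv (m : ℝ) (V : (Fin 3 → ℝ) → ℝ) (hV : Differentiable ℝ V)
    (z w : Vec 3 × Vec 3) (hz : z.2 0 = 1) :
    fderiv ℝ (LL m V) z w = m * (z.2 1 * w.2 1 + z.2 2 * w.2 2 + z.2 3 * w.2 3)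
      - m / 2 * ((z.2 1) ^ 2 + (z.2 2) ^ 2 + (z.2 3) ^ 2) * w.2 0
      - V (fun a => z.1 a.succ) * w.2 0
      - fderiv ℝ V (fun a => z.1 a.succ) (fun a => w.1 a.succ) := by
  have hy : ∀ i : Fin 4, HasFDerivAt (fun z : Vec 3 × Vec 3 => z.2 i)
      ((ContinuousLinearMap.proj (R := ℝ) (φ := fun _ : Fin 4 => ℝ) i).comp
        (ContinuousLinearMap.snd ℝ (Vec 3) (Vec 3))) z := fun i =>
    ((ContinuousLinearMap.proj (R := ℝ) (φ := fun _ : Fin 4 => ℝ) i).comp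
        (ContinuousLinearMap.snd ℝ (Vec 3) (Vec 3))).hasFDerivAt
  let P : Vec 3 × Vec 3 →L[ℝ] (Fin 3 → ℝ) :=
    (ContinuousLinearMap.pi (fun a : Fin 3 =>
      ContinuousLinearMap.proj (R := ℝ) (φ := fun _ : Fin 4 => ℝ) a.succ)).comp
        (ContinuousLinearMap.fst ℝ (Vec 3) (Vec 3))
  have hP : HasFDerivAt (fun z : Vec 3 × Vec 3 => V (P z)) ((fderiv ℝ V (P z)).comp P) z :=
    (hV (P z)).hasFDerivAt.comp z P.hasFDerivAt
  have hinv := (hasDerivAt_inv (x := z.2 0) (by rw [hz]; norm_num)).comp_hasFDerivAt z (hy 0)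
  have key := ((((((hy 1).pow 2).add ((hy 2).pow 2)).add ((hy 3).pow 2)).const_mul (m/2)).mul
    hinv).sub (hP.mul (hy 0))
  have e : fderiv ℝ (LL m V) z = _ := HasFDerivAt.fderiv key
  rw [e]
  have hPz : P z = fun a => z.1 a.succ := rfl
  have hPw : P w = fun a => w.1 a.succ := rfl
  simp [hz, hPz, hPw]
  ring

lemma fderiv_expand_s13 (V : (Fin 3 → ℝ) → ℝ) (x v : Fin 3 → ℝ) :
    fderiv ℝ V x v = v 0 * fderiv ℝ V x (Pi.single 0 1) + v 1 * fderiv ℝ V x (Pi.single 1 1)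
      + v 2 * fderiv ℝ V x (Pi.single 2 1) := by
  have : v = v 0 • Pi.single 0 1 + v 1 • Pi.single 1 1 + v 2 • Pi.single 2 (1:ℝ) := by
    ext i; fin_cases i <;> simp
  conv_lhs => rw [this]
  simp only [map_add, map_smul, smul_eq_mul]

/-- Potential system reduces to Newton's equation: for the Finsler
metric `L = (m/2)((y¹)²+(y²)²+(y³)²)/y⁰ − V(x¹,x²,x³) y⁰` and the parameterised curve
`c(t) = (t, q(t))`, the Euler–Lagrange equations hold on `I` iff
`m q̈^a = −∂V/∂x^a(q)` on `I`. -/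
theorem statement13 (m : ℝ) (hm : 0 < m)
    (V : (Fin 3 → ℝ) → ℝ) (hV : ContDiff ℝ (⊤ : ℕ∞) V)
    (L : Vec 3 × Vec 3 → ℝ)
    (hL : L = fun z =>
      m / 2 * ((z.2 1) ^ 2 + (z.2 2) ^ 2 + (z.2 3) ^ 2) / z.2 0
        - V (fun a => z.1 a.succ) * z.2 0)
    (t₀ t₁ : ℝ) (I : Set ℝ) (hI : I = Set.Ioo t₀ t₁)
    (q : ℝ → Fin 3 → ℝ) (hq : ContDiffOn ℝ (⊤ : ℕ∞) q I)
    (c : ℝ → Vec 3) (hc : c = fun t => Fin.cons (α := fun _ => ℝ) t (q t)) :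
    (∀ t ∈ I, ∀ μ : Fin 4,
      deriv (fun s => pdy μ L (c s, deriv c s)) t = pdx μ L (c t, deriv c t))
    ↔ (∀ t ∈ I, ∀ a : Fin 3,
        m * deriv (fun s => deriv (fun r => q r a) s) t
          = -(fderiv ℝ V (q t) (Pi.single a 1))) := by
  have hVd : Differentiable ℝ V := hV.differentiable (by simp)
  have hL' : L = LL m V := hL
  subst hL'
  have hIo : IsOpen I := hI ▸ isOpen_Ioo
  have hqa : ∀ a, ContDiffOn ℝ (⊤ : ℕ∞) (fun r => q r a) I := fun a => contDiffOn_pi.1 hq a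
  have hd1 : ∀ t ∈ I, ∀ a, HasDerivAt (fun r => q r a) (deriv (fun r => q r a) t) t :=
    fun t ht a => (((hqa a).differentiableOn (by simp)).differentiableAt
      (hIo.mem_nhds ht)).hasDerivAt
  have hd2 : ∀ t ∈ I, ∀ a, HasDerivAt (fun s => deriv (fun r => q r a) s)
      (deriv (fun s => deriv (fun r => q r a) s) t) t :=
    fun t ht a => ((((hqa a).deriv_of_isOpen (m := 1) hIo 
      (by norm_cast)).differentiableOn
      (by simp)).differentiableAt (hIo.mem_nhds ht)).hasDerivAt
  have hcd : ∀ t ∈ I, deriv c t =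
      Fin.cons (α := fun _ => ℝ) 1 (fun a => deriv (fun r => q r a) t) := by
    intro t ht
    apply HasDerivAt.deriv
    rw [hasDerivAt_pi]
    intro i
    subst hc
    refine Fin.cases ?_ (fun a => ?_) i
    · exact hasDerivAt_id' t
    · simpa using hd1 t ht a
  have h0 : ∀ t ∈ I, (deriv c t) 0 = 1 := fun t ht => by rw [hcd t ht]; rfl
  have hS : ∀ t ∈ I, ∀ a : Fin 3, (deriv c t) a.succ = deriv (fun r => q r a) t :=
    fun t ht a => by rw [hcd t ht]; rfl
  have h1 : ∀ t ∈ I, (deriv c t) 1 = deriv (fun r => q r 0) t := fun t ht => hS t ht 0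
  have h2 : ∀ t ∈ I, (deriv c t) 2 = deriv (fun r => q r 1) t := fun t ht => hS t ht 1
  have h3 : ∀ t ∈ I, (deriv c t) 3 = deriv (fun r => q r 2) t := fun t ht => hS t ht 2
  have hcq : ∀ t, (fun a : Fin 3 => c t a.succ) = q t := fun t => by subst hc; ext a; simp
  have px0 : ∀ t ∈ I, pdx 0 (LL m V) (c t, deriv c t) = 0 := by
    intro t ht
    have hz : (fun a : Fin 3 => (Pi.single 0 1 : Vec 3) a.succ) = 0 := by
      ext a; simp
    rw [pdx, LL_fderiv m V hVd _ _ (h0 t ht)]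
    simp only [hz]
    simp
  have pxS : ∀ t ∈ I, ∀ a : Fin 3, pdx a.succ (LL m V) (c t, deriv c t)
      = -(fderiv ℝ V (q t) (Pi.single a 1)) := by
    intro t ht a
    have hz : (fun b : Fin 3 => (Pi.single a.succ 1 : Vec 3) b.succ) = Pi.single a 1 := by
      ext b; simp [Pi.single_apply]
    rw [pdx, LL_fderiv m V hVd _ _ (h0 t ht)]
    simp only [hz, hcq]
    simp
  have py0 : ∀ t ∈ I, pdy 0 (LL m V) (c t, deriv c t) =
      - (m / 2 * ((deriv (fun r => q r 0) t) ^ 2 + (deriv (fun r => q r 1) t) ^ 2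
        + (deriv (fun r => q r 2) t) ^ 2)) - V (q t) := by
    intro t ht
    have hz : (fun b : Fin 3 => (0 : Vec 3) b.succ) = 0 := rfl
    rw [pdy, LL_fderiv m V hVd _ _ (h0 t ht)]
    simp only [hz, hcq, h1 t ht, h2 t ht, h3 t ht]
    simp
  have pyS : ∀ t ∈ I, ∀ a : Fin 3, pdy a.succ (LL m V) (c t, deriv c t) =
      m * deriv (fun r => q r a) t := by
    intro t ht a
    have hz : (fun b : Fin 3 => (0 : Vec 3) b.succ) = 0 := rfl
    rw [pdy, LL_fderiv m V hVd _ _ (h0 t ht)]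
    simp only [hz, hcq, h1 t ht, h2 t ht, h3 t ht]
    fin_cases a <;> simp [Pi.single_apply]
  have eS : ∀ t ∈ I, ∀ a : Fin 3,
      deriv (fun s => pdy a.succ (LL m V) (c s, deriv c s)) t
        = m * deriv (fun s => deriv (fun r => q r a) s) t := by
    intro t ht a
    have : (fun s => pdy a.succ (LL m V) (c s, deriv c s)) =ᶠ[nhds t]
        fun s => m * deriv (fun r => q r a) s := by
      filter_upwards [hIo.mem_nhds ht] with s hs using pyS s hs a
    rw [this.deriv_eq]
    exact ((hd2 t ht a).const_mul m).deriv
  have e0 : ∀ t ∈ I,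
      deriv (fun s => pdy 0 (LL m V) (c s, deriv c s)) t
        = - (m * (deriv (fun r => q r 0) t * deriv (fun s => deriv (fun r => q r 0) s) t
          + deriv (fun r => q r 1) t * deriv (fun s => deriv (fun r => q r 1) s) t
          + deriv (fun r => q r 2) t * deriv (fun s => deriv (fun r => q r 2) s) t))
          - fderiv ℝ V (q t) (fun a => deriv (fun r => q r a) t) := by
    intro t ht
    have : (fun s => pdy 0 (LL m V) (c s, deriv c s)) =ᶠ[nhds t]
        fun s => - (m / 2 * ((deriv (fun r => q r 0) s) ^ 2 + (deriv (fun r => q r 1) s) ^ 2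
        + (deriv (fun r => q r 2) s) ^ 2)) - V (q s) := by
      filter_upwards [hIo.mem_nhds ht] with s hs using py0 s hs
    rw [this.deriv_eq]
    have hqd : HasDerivAt q (fun a => deriv (fun r => q r a) t) t :=
      hasDerivAt_pi.2 (hd1 t ht)
    have hVq : HasDerivAt (fun s => V (q s))
        (fderiv ℝ V (q t) (fun a => deriv (fun r => q r a) t)) t :=
      (hVd (q t)).hasFDerivAt.comp_hasDerivAt t hqd
    have key := (((((hd2 t ht 0).pow 2).add ((hd2 t ht 1).pow 2)).add
      ((hd2 t ht 2).pow 2)).const_mul (m / 2)).neg.sub hVq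
    refine (HasDerivAt.deriv key).trans ?_
    simp
    ring
  constructor
  · intro h t ht a
    rw [← eS t ht a, ← pxS t ht a]
    exact h t ht a.succ
  · intro h t ht μ
    refine Fin.cases ?_ (fun a => ?_) μ
    · rw [e0 t ht, px0 t ht, fderiv_expand_s13]
      have a0 := h t ht 0
      have a1 := h t ht 1
      have a2 := h t ht 2
      linear_combination (-deriv (fun r => q r 0) t) * a0 - deriv (fun r => q r 1) t * a1
        - deriv (fun r => q r 2) t * a2
    · rw [eS t ht a, pxS t ht a]
      exact h t ht a
end
end

section
/- (Second-class constrained system.) Define the singular Finsler metric L(x⁰,x¹,x²; y⁰,y¹,y²) := x¹ y² − x² y¹ + ((x¹)² + (x²)²) y⁰ on ℝ³ × {y ∈ ℝ³ : y⁰ > 0}. Its y-Hessian vanishes identically, (L_{μν}) = 0. Let x¹, x² : I → ℝ be smooth functions on an open interval I and consider the parameterised curve c(t) := (t, x¹(t), x²(t)). Then c satisfies the Euler–Lagrange equations (d/dt)[(∂L/∂y^μ)(c(t),ċ(t))] = (∂L/∂x^μ)(c(t),ċ(t)) for all μ = 0,1,2 if and only if ẋ¹(t) = x²(t) and ẋ²(t)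 = −x¹(t) for all t ∈ I (so that x¹ and x² are harmonic-oscillator solutions, ẍ¹ = −x¹, ẍ² = −x²). -/
open scoped BigOperators

noncomputable section

theorem st14_hasFDerivAt (z : Vec 2 × Vec 2) :
    ∃ D : (Vec 2 × Vec 2) →L[ℝ] ℝ, HasFDerivAt (fun z : Vec 2 × Vec 2 =>
      z.1 1 * z.2 2 - z.1 2 * z.2 1 + ((z.1 1) ^ 2 + (z.1 2) ^ 2) * z.2 0) D z ∧
      ∀ v : Vec 2 × Vec 2, D v = v.1 1 * z.2 2 + z.1 1 * v.2 2 - (v.1 2 * z.2 1 + z.1 2 * v.2 1)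
        + ((2 * z.1 1 * v.1 1 + 2 * z.1 2 * v.1 2) * z.2 0
          + ((z.1 1) ^ 2 + (z.1 2) ^ 2) * v.2 0) := by
  have hx : ∀ i : Fin 3, HasFDerivAt (fun z : Vec 2 × Vec 2 => z.1 i)
      ((ContinuousLinearMap.proj (R := ℝ) (φ := fun _ : Fin 3 => ℝ) i).comp
        (ContinuousLinearMap.fst ℝ (Vec 2) (Vec 2))) z := fun i =>
    ((ContinuousLinearMap.proj (R := ℝ) (φ := fun _ : Fin 3 => ℝ) i).comp
        (ContinuousLinearMap.fst ℝ (Vec 2) (Vec 2))).hasFDerivAt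
  have hy : ∀ i : Fin 3, HasFDerivAt (fun z : Vec 2 × Vec 2 => z.2 i)
      ((ContinuousLinearMap.proj (R := ℝ) (φ := fun _ : Fin 3 => ℝ) i).comp
        (ContinuousLinearMap.snd ℝ (Vec 2) (Vec 2))) z := fun i =>
    ((ContinuousLinearMap.proj (R := ℝ) (φ := fun _ : Fin 3 => ℝ) i).comp
        (ContinuousLinearMap.snd ℝ (Vec 2) (Vec 2))).hasFDerivAt
  refine ⟨_, (((hx 1).mul (hy 2)).sub ((hx 2).mul (hy 1))).add
    ((((hx 1).pow 2).add ((hx 2).pow 2)).mul (hy 0)), ?_⟩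
  intro v
  simp
  ring

/-- Second-class constrained system: for the singular Finsler metric
`L = x¹ y² − x² y¹ + ((x¹)² + (x²)²) y⁰` the `y`-Hessian vanishes identically, and for
the parameterised curve `c(t) = (t, x¹(t), x²(t))` the Euler–Lagrange equations hold on
`I` iff `ẋ¹ = x²` and `ẋ² = −x¹` on `I` (so that `ẍ¹ = −x¹` and `ẍ² = −x²`). -/
theorem statement14
    (L : Vec 2 × Vec 2 → ℝ)
    (hL : L = fun z =>
      z.1 1 * z.2 2 - z.1 2 * z.2 1 + ((z.1 1) ^ 2 + (z.1 2) ^ 2) * z.2 0)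
    (t₀ t₁ : ℝ) (I : Set ℝ) (hI : I = Set.Ioo t₀ t₁)
    (x₁ x₂ : ℝ → ℝ)
    (hx₁ : ContDiffOn ℝ (⊤ : ℕ∞) x₁ I) (hx₂ : ContDiffOn ℝ (⊤ : ℕ∞) x₂ I)
    (c : ℝ → Vec 2) (hc : c = fun t => ![t, x₁ t, x₂ t]) :
    -- the y-Hessian vanishes identically
    (∀ z : Vec 2 × Vec 2, 0 < z.2 0 → ∀ μ ν : Fin 3, pdy μ (pdy ν L) z = 0) ∧
    -- the Euler–Lagrange equations characterise the harmonic-oscillator flow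
    ((∀ t ∈ I, ∀ μ : Fin 3,
        deriv (fun s => pdy μ L (c s, deriv c s)) t = pdx μ L (c t, deriv c t))
      ↔ (∀ t ∈ I, deriv x₁ t = x₂ t ∧ deriv x₂ t = -(x₁ t))) ∧
    -- so that x¹, x² are harmonic-oscillator solutions
    ((∀ t ∈ I, deriv x₁ t = x₂ t ∧ deriv x₂ t = -(x₁ t)) →
      ∀ t ∈ I, deriv (deriv x₁) t = -(x₁ t) ∧ deriv (deriv x₂) t = -(x₂ t)) := by
  have hfd : ∀ z v : Vec 2 × Vec 2, fderiv ℝ L z v =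
      v.1 1 * z.2 2 + z.1 1 * v.2 2 - (v.1 2 * z.2 1 + z.1 2 * v.2 1)
        + ((2 * z.1 1 * v.1 1 + 2 * z.1 2 * v.1 2) * z.2 0
          + ((z.1 1) ^ 2 + (z.1 2) ^ 2) * v.2 0) := by
    intro z v
    obtain ⟨D, hD, h⟩ := st14_hasFDerivAt z
    rw [hL, hD.fderiv, h]
  have y0 : pdy 0 L = fun z => (z.1 1) ^ 2 + (z.1 2) ^ 2 := by
    funext z; simp [pdy, hfd]
  have y1 : pdy 1 L = fun z => -(z.1 2) := by
    funext z; simp [pdy, hfd]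
  have y2 : pdy 2 L = fun z => z.1 1 := by
    funext z; simp [pdy, hfd]
  have x0 : ∀ z, pdx 0 L z = 0 := by
    intro z; simp [pdx, hfd]
  have x1 : ∀ z, pdx 1 L z = z.2 2 + 2 * z.1 1 * z.2 0 := by
    intro z; simp [pdx, hfd]
  have x2 : ∀ z, pdx 2 L z = -(z.2 1) + 2 * z.1 2 * z.2 0 := by
    intro z; simp [pdx, hfd]
  have hopen : IsOpen I := hI ▸ isOpen_Ioo
  have d1 : ∀ t ∈ I, HasDerivAt x₁ (deriv x₁ t) t := fun t ht =>
    ((hx₁.differentiableOn (by simp)).differentiableAt (hopen.mem_nhds ht)).hasDerivAt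
  have d2 : ∀ t ∈ I, HasDerivAt x₂ (deriv x₂ t) t := fun t ht =>
    ((hx₂.differentiableOn (by simp)).differentiableAt (hopen.mem_nhds ht)).hasDerivAt
  have dc : ∀ t ∈ I, deriv c t = ![1, deriv x₁ t, deriv x₂ t] := by
    intro t ht
    apply HasDerivAt.deriv
    rw [hasDerivAt_pi, hc]
    intro i
    fin_cases i
    · simpa using hasDerivAt_id' t
    · simpa using d1 t ht
    · simpa using d2 t ht
  refine ⟨?_, ?_, ?_⟩
  · intro z _ μ ν
    have key : ∀ g : Vec 2 → ℝ, Differentiable ℝ g →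
        pdy μ (fun z : Vec 2 × Vec 2 => g z.1) z = 0 := by
      intro g hg
      have h := (hg z.1).hasFDerivAt.comp z
        (hasFDerivAt_fst (𝕜 := ℝ) (E := Vec 2) (F := Vec 2) (p := z))
      have h' : HasFDerivAt (fun z : Vec 2 × Vec 2 => g z.1) _ z := h
      unfold pdy
      rw [h'.fderiv]
      simp
    fin_cases ν
    · show pdy μ (pdy 0 L) z = 0
      rw [y0]
      exact key (fun x => (x 1) ^ 2 + (x 2) ^ 2) (by fun_prop)
    · show pdy μ (pdy 1 L) z = 0
      rw [y1]
      exact key (fun x => -(x 2)) (by fun_prop)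
    · show pdy μ (pdy 2 L) z = 0
      rw [y2]
      exact key (fun x => x 1) (by fun_prop)
  · refine forall₂_congr fun t ht => ?_
    have e0 : deriv (fun s => pdy 0 L (c s, deriv c s)) t
        = 2 * x₁ t * deriv x₁ t + 2 * x₂ t * deriv x₂ t := by
      rw [y0, hc]
      have h := ((d1 t ht).pow 2).add ((d2 t ht).pow 2)
      refine HasDerivAt.deriv ?_
      convert h using 1
      · rfl
      · simp
    have e1 : deriv (fun s => pdy 1 L (c s, deriv c s)) t = - deriv x₂ t := by
      rw [y1, hc]
      exact (d2 t ht).neg.deriv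
    have e2 : deriv (fun s => pdy 2 L (c s, deriv c s)) t = deriv x₁ t := by
      rw [y2, hc]
      exact (d1 t ht).deriv
    have c1 : c t 1 = x₁ t := by rw [hc]; rfl
    have c2 : c t 2 = x₂ t := by rw [hc]; rfl
    have f1 : pdx 1 L (c t, deriv c t) = deriv x₂ t + 2 * x₁ t := by
      rw [x1, dc t ht]; simp [c1]
    have f2 : pdx 2 L (c t, deriv c t) = - deriv x₁ t + 2 * x₂ t := by
      rw [x2, dc t ht]; simp [c2]
    constructor
    · intro h
      have h1 := h 1
      have h2 := h 2
      rw [e1, f1] at h1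
      rw [e2, f2] at h2
      constructor <;> linarith
    · rintro ⟨h1, h2⟩ μ
      fin_cases μ
      · refine e0.trans (Eq.trans ?_ (x0 _).symm)
        rw [h1, h2]; ring
      · refine e1.trans (Eq.trans ?_ f1.symm)
        rw [h2]; ring
      · refine e2.trans (Eq.trans ?_ f2.symm)
        rw [h1]; ring
  · intro h t ht
    have ev := hopen.mem_nhds ht
    have g1 : deriv x₁ =ᶠ[nhds t] x₂ := by
      filter_upwards [ev] with s hs using (h s hs).1
    have g2 : deriv x₂ =ᶠ[nhds t] fun s => -(x₁ s) := by
      filter_upwards [ev] with s hs using (h s hs).2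
    rw [g1.deriv_eq, g2.deriv_eq]
    refine ⟨(h t ht).2, ?_⟩
    rw [← (h t ht).1]
    exact (d1 t ht).neg.deriv
end
end

section
/- (Frenkel's model.) Define the singular Finsler metric L(x⁰,x¹,x²,x³; y⁰,y¹,y²,y³) := y²(y³)²/(y⁰)² − ½ x¹ (x³)² y⁰ on ℝ⁴ × {y ∈ ℝ⁴ : y⁰ > 0}. Let x¹, x², x³ : I → ℝ be smooth functions on an open interval I and consider the parameterised curve c(t) := (t, x¹(t), x²(t), x³(t)). Then c satisfies the Euler–Lagrange equations (d/dt)[(∂L/∂y^μ)(c(t),ċ(t))] = (∂L/∂x^μ)(c(t),ċ(t)) for all μ = 0,1,2,3 if and only if x³(t) = 0 for all t ∈ I; in particular x¹ and x² are arbitrary smooth functions on solutions. -/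
open scoped BigOperators

noncomputable section

/-- The differential of Frenkel's metric at a vector with `y⁰ = 1`. -/
lemma frenkel_fderiv (z v : Vec 3 × Vec 3) (h0 : z.2 0 = 1) :
    fderiv ℝ (fun z : Vec 3 × Vec 3 =>
      z.2 2 * (z.2 3) ^ 2 / (z.2 0) ^ 2 - 1 / 2 * z.1 1 * (z.1 3) ^ 2 * z.2 0) z v
    = v.2 2 * (z.2 3) ^ 2 + 2 * z.2 2 * z.2 3 * v.2 3 - 2 * z.2 2 * (z.2 3) ^ 2 * v.2 0
      - 1 / 2 * (v.1 1 * (z.1 3) ^ 2 + 2 * z.1 1 * z.1 3 * v.1 3) - 1 / 2 * z.1 1 * (z.1 3) ^ 2 * v.2 0 := by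
  have hd : DifferentiableAt ℝ (fun z : Vec 3 × Vec 3 =>
      z.2 2 * (z.2 3) ^ 2 / (z.2 0) ^ 2 - 1 / 2 * z.1 1 * (z.1 3) ^ 2 * z.2 0) z := by
    have : z.2 0 ^ 2 ≠ 0 := by rw [h0]; norm_num
    fun_prop (disch := assumption)
  rw [← hd.lineDeriv_eq_fderiv]
  apply HasLineDerivAt.lineDeriv
  unfold HasLineDerivAt
  have ha : ∀ a b : ℝ, HasDerivAt (fun t : ℝ => a + t * b) b 0 := fun a b => by
    simpa using ((hasDerivAt_id (0 : ℝ)).mul_const b).const_add a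
  have key := (((ha (z.2 2) (v.2 2)).mul ((ha (z.2 3) (v.2 3)).pow 2)).div
    ((ha (z.2 0) (v.2 0)).pow 2) (by simp [h0])).sub
    ((((ha (z.1 1) (v.1 1)).const_mul (1 / 2)).mul ((ha (z.1 3) (v.1 3)).pow 2)).mul
      (ha (z.2 0) (v.2 0)))
  refine key.congr_deriv ?_
  simp [h0]
  ring

/-- Velocity of the curve at interior points. -/
lemma frenkel_deriv (t : ℝ) (x₁ x₂ x₃ : ℝ → ℝ) (h₁ : DifferentiableAt ℝ x₁ t)
    (h₂ : DifferentiableAt ℝ x₂ t) (h₃ : DifferentiableAt ℝ x₃ t) :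
    deriv (fun t => (![t, x₁ t, x₂ t, x₃ t] : Vec 3)) t
      = ![1, deriv x₁ t, deriv x₂ t, deriv x₃ t] := by
  apply HasDerivAt.deriv
  rw [hasDerivAt_pi]
  intro i
  fin_cases i
  · exact hasDerivAt_id t
  · exact h₁.hasDerivAt
  · exact h₂.hasDerivAt
  · exact h₃.hasDerivAt

/-- Frenkel's model: for the singular Finsler metric
`L = y²(y³)²/(y⁰)² − ½ x¹ (x³)² y⁰` and the parameterised curve
`c(t) = (t, x¹(t), x²(t), x³(t))`, the Euler–Lagrange equations hold on `I` iff
`x³ ≡ 0` on `I` (so `x¹`, `x²` are arbitrary smooth functions on solutions). -/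
theorem statement15
    (L : Vec 3 × Vec 3 → ℝ)
    (hL : L = fun z =>
      z.2 2 * (z.2 3) ^ 2 / (z.2 0) ^ 2 - 1 / 2 * z.1 1 * (z.1 3) ^ 2 * z.2 0)
    (t₀ t₁ : ℝ) (I : Set ℝ) (hI : I = Set.Ioo t₀ t₁)
    (x₁ x₂ x₃ : ℝ → ℝ)
    (hx₁ : ContDiffOn ℝ (⊤ : ℕ∞) x₁ I) (hx₂ : ContDiffOn ℝ (⊤ : ℕ∞) x₂ I)
    (hx₃ : ContDiffOn ℝ (⊤ : ℕ∞) x₃ I)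
    (c : ℝ → Vec 3) (hc : c = fun t => ![t, x₁ t, x₂ t, x₃ t]) :
    (∀ t ∈ I, ∀ μ : Fin 4,
      deriv (fun s => pdy μ L (c s, deriv c s)) t = pdx μ L (c t, deriv c t))
    ↔ (∀ t ∈ I, x₃ t = 0) := by
  subst hL hI hc
  have hD : ∀ x : ℝ → ℝ, ContDiffOn ℝ (⊤ : ℕ∞) x (Set.Ioo t₀ t₁) → ∀ t ∈ Set.Ioo t₀ t₁,
      DifferentiableAt ℝ x t := fun x hx t ht =>
    (hx.differentiableOn (by simp)).differentiableAt (isOpen_Ioo.mem_nhds ht)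
  have hV : ∀ t ∈ Set.Ioo t₀ t₁, deriv (fun t => (![t, x₁ t, x₂ t, x₃ t] : Vec 3)) t
      = ![1, deriv x₁ t, deriv x₂ t, deriv x₃ t] := fun t ht =>
    frenkel_deriv t x₁ x₂ x₃ (hD _ hx₁ t ht) (hD _ hx₂ t ht) (hD _ hx₃ t ht)
  constructor
  · intro h t ht
    have h1 := h t ht 1
    have hz : (fun s => pdy 1 (fun z : Vec 3 × Vec 3 =>
        z.2 2 * (z.2 3) ^ 2 / (z.2 0) ^ 2 - 1 / 2 * z.1 1 * (z.1 3) ^ 2 * z.2 0)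
        ((![s, x₁ s, x₂ s, x₃ s] : Vec 3),
          deriv (fun t => (![t, x₁ t, x₂ t, x₃ t] : Vec 3)) s)) =ᶠ[nhds t] fun _ => (0 : ℝ) := by
      filter_upwards [isOpen_Ioo.mem_nhds ht] with s hs
      rw [hV s hs]
      unfold pdy
      rw [frenkel_fderiv _ _ (by simp)]
      simp [Pi.single_apply]
    rw [hz.deriv_eq, hV t ht] at h1
    unfold pdx at h1
    rw [frenkel_fderiv _ _ (by simp)] at h1
    simpa [Pi.single_apply] using h1
  · intro h t ht μ
    have hx' : ∀ s ∈ Set.Ioo t₀ t₁, deriv x₃ s = 0 := fun s hs => by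
      have : x₃ =ᶠ[nhds s] fun _ => (0 : ℝ) := by
        filter_upwards [isOpen_Ioo.mem_nhds hs] with r hr using h r hr
      rw [this.deriv_eq]; simp
    have hz : (fun s => pdy μ (fun z : Vec 3 × Vec 3 =>
        z.2 2 * (z.2 3) ^ 2 / (z.2 0) ^ 2 - 1 / 2 * z.1 1 * (z.1 3) ^ 2 * z.2 0)
        ((![s, x₁ s, x₂ s, x₃ s] : Vec 3),
          deriv (fun t => (![t, x₁ t, x₂ t, x₃ t] : Vec 3)) s)) =ᶠ[nhds t] fun _ => (0 : ℝ) := by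
      filter_upwards [isOpen_Ioo.mem_nhds ht] with s hs
      rw [hV s hs]
      unfold pdy
      rw [frenkel_fderiv _ _ (by simp)]
      simp [h s hs, hx' s hs]
    rw [hz.deriv_eq, hV t ht]
    unfold pdx
    rw [frenkel_fderiv _ _ (by simp)]
    simp [h t ht, hx' t ht]
end
end
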